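/- arXiv:1701.05430 — 4 statements merged into one kernel-verified Lean document; each statement's English description precedes it below -/
import Mathlib

section
/- Let k ⊆ L ⊆ K be q-finite purely inseparable extensions of characteristic p > 0. Then di(K/k) ≤ di(K/L) + di(L/k), with equality if and only if L and k(K^p) are linearly disjoint over k(L^p). -/
/-!
Common definitions: purely inseparable extension theory (r-bases, degree of
irrationality, relative perfect closure, modularity), following Fliouet,
"Extensions absolument lq-finies".
-/

open IntermediateField

noncomputable section

/-- `k(K^p)`: the intermediate field of `K/k` generated by the `p`-th powers of `K`. -/
def pClosure (k K : Type*) [Field k] [Field K] [Algebra k K] (p : ℕ) : IntermediateField k K :=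
  adjoin k {x : K | ∃ y : K, y ^ p = x}

/-- `k(K^{p^n})`. -/
def pnClosure (k K : Type*) [Field k] [Field K] [Algebra k K] (p n : ℕ) : IntermediateField k K :=
  adjoin k {x : K | ∃ y : K, y ^ p ^ n = x}

/-- `k(L^p)` for an intermediate field `L` of `Ω/k`. -/
def pClosureOf {k Ω : Type*} [Field k] [Field Ω] [Algebra k Ω] (p : ℕ)
    (L : IntermediateField k Ω) : IntermediateField k Ω :=
  adjoin k {x : Ω | ∃ y ∈ L, y ^ p = x}

/-- `B` is `r`-free over the intermediate field `L` (typically `L = k(K^p)`):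
no `x ∈ B` belongs to `L(B \ {x})`. -/
def RFreeOver {k K : Type*} [Field k] [Field K] [Algebra k K]
    (L : IntermediateField k K) (B : Set K) : Prop :=
  ∀ x ∈ B, x ∉ adjoin L (B \ {x})

/-- `B` is an `r`-basis of `K/k` : `K = k(K^p)(B)` and `B` is `r`-free over `k(K^p)`. -/
def RBasis (k K : Type*) [Field k] [Field K] [Algebra k K] (p : ℕ) (B : Set K) : Prop :=
  adjoin (pClosure k K p) B = ⊤ ∧ RFreeOver (pClosure k K p) B

/-- `B` is an `r`-basis of `L/F` where `F ≤ L` are intermediate fields of `Ω/k`: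
`L = F(L^p)(B)` and no `x ∈ B` lies in `F(L^p)(B \ {x})`. -/
def RBasisRel {k Ω : Type*} [Field k] [Field Ω] [Algebra k Ω] (p : ℕ)
    (F L : IntermediateField k Ω) (B : Set Ω) : Prop :=
  B ⊆ (L : Set Ω) ∧ F ⊔ pClosureOf p L ⊔ adjoin k B = L ∧
    ∀ x ∈ B, x ∉ F ⊔ pClosureOf p L ⊔ adjoin k (B \ {x})

/-- The degree of irrationality of a bounded-exponent extension:
the cardinality of an `r`-basis of `K/k`. -/
def diCard (k K : Type*) [Field k] [Field K] [Algebra k K] (p : ℕ) : Cardinal :=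
  sInf {c : Cardinal | ∃ B : Set K, RBasis k K p B ∧ Cardinal.mk B = c}

/-- `k^{p^{-n}} ∩ K = {x ∈ K | x^{p^n} ∈ k}`. -/
def expleq (k K : Type*) [Field k] [Field K] [Algebra k K] (p n : ℕ) : IntermediateField k K :=
  adjoin k {x : K | x ^ p ^ n ∈ (algebraMap k K).range}

/-- The degree of irrationality `di(K/k) = sup_n di(k^{p^{-n}} ∩ K / k)`. -/
def di (k K : Type*) [Field k] [Field K] [Algebra k K] (p : ℕ) : Cardinal :=
  ⨆ n : ℕ, diCard k (expleq k K p n) p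

/-- The relative perfect closure `rp(K/k)`: the largest intermediate field `L`
with `k(L^p) = L`. -/
def rp (k K : Type*) [Field k] [Field K] [Algebra k K] (p : ℕ) : IntermediateField k K :=
  sSup {L : IntermediateField k K | pClosureOf p L = L}

/-- `K/k` has unbounded exponent. -/
def UnboundedExp (k K : Type*) [Field k] [Field K] [Algebra k K] (p : ℕ) : Prop :=
  ∀ e : ℕ, ∃ x : K, x ^ p ^ e ∉ (algebraMap k K).range

/-- `K^{p^n}` as a subfield of `K`. -/
def pnPowers (K : Type*) [Field K] (p n : ℕ) : Subfield K :=
  Subfield.closure {x : K | ∃ y : K, y ^ p ^ n = x}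

/-- `K/k` is modular: for each `n`, `K^{p^n}` and `k` are linearly disjoint over
`K^{p^n} ∩ k`, i.e. every finite family of elements of `K^{p^n}` that is linearly
independent over `K^{p^n} ∩ k` remains linearly independent over `k`. -/
def Modular (k K : Type*) [Field k] [Field K] [Algebra k K] (p : ℕ) : Prop :=
  ∀ n : ℕ, ∀ s : Finset K, (↑s : Set K) ⊆ (pnPowers K p n : Set K) →
    LinearIndependent ↥(pnPowers K p n ⊓ (algebraMap k K).fieldRange)
      (fun x : s => (x : K)) →
    LinearIndependent ↥((algebraMap k K).fieldRange) (fun x : s => (x : K))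

/-- The exponent `o(a, F)` of `a` over an intermediate field `F`:
the least `m` with `a^{p^m} ∈ F`. -/
def expOf {k K : Type*} [Field k] [Field K] [Algebra k K] (p : ℕ)
    (F : IntermediateField k K) (a : K) : ℕ :=
  sInf {m : ℕ | a ^ p ^ m ∈ F}

/-- An intermediate field `L` of `K/k` is equiexponential of exponent `e` over `k`:
there is an `r`-basis `G` of `L/k` with `o(a, k(G \ {a})) = o(a, k) = e` for all `a ∈ G`. -/
def EquiExpOf {k K : Type*} [Field k] [Field K] [Algebra k K] (p : ℕ)
    (e : ℕ) (L : IntermediateField k K) : Prop :=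
  ∃ G : Set K, RBasisRel p ⊥ L G ∧
    ∀ a ∈ G, expOf p (adjoin k (G \ {a})) a = e ∧ expOf p (⊥ : IntermediateField k K) a = e

end

section RelLemmas
variable {k K : Type*} [Field k] [Field K] [Algebra k K]

theorem di_sup_span [Algebra.IsAlgebraic k K] (F : IntermediateField k K) (T : Submonoid K) {x : K}
    (hx : x ∈ F ⊔ adjoin k (T : Set K)) : x ∈ Submodule.span F (T : Set K) := by
  have h1 : F ⊔ adjoin k (T : Set K) = (adjoin F (T : Set K)).restrictScalars k := by
    apply le_antisymm
    · refine sup_le ?_ (adjoin_le_iff.2 ?_)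
      · intro y hy
        exact (adjoin F (T : Set K)).algebraMap_mem ⟨y, hy⟩
      · intro y hy
        exact subset_adjoin F (T : Set K) hy
    · have : adjoin F (T : Set K) ≤ extendScalars (le_sup_left : F ≤ F ⊔ adjoin k (T : Set K)) := by
        rw [adjoin_le_iff]
        intro y hy
        exact (le_sup_right : adjoin k (T : Set K) ≤ F ⊔ adjoin k (T : Set K))
          (subset_adjoin k (T : Set K) hy)
      exact this
  rw [h1] at hx
  have hx' : x ∈ (adjoin F (T : Set K)).toSubalgebra := hx
  rw [adjoin_toSubalgebra_of_isAlgebraic (fun y _ =>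
    (Algebra.IsAlgebraic.isAlgebraic (R := k) y).tower_top F)] at hx'
  have h2 : x ∈ Subalgebra.toSubmodule (Algebra.adjoin F (T : Set K)) := hx'
  rw [Algebra.adjoin_eq_span] at h2
  simpa using h2

theorem di_span_mono {F F' : IntermediateField k K} (h : F ≤ F') {s : Set K} {x : K}
    (hx : x ∈ Submodule.span F s) : x ∈ Submodule.span F' s := by
  induction hx using Submodule.span_induction with
  | mem x hx => exact Submodule.subset_span hx
  | zero => exact Submodule.zero_mem _
  | add x y _ _ h1 h2 => exact Submodule.add_mem _ h1 h2
  | smul a x _ hx => exact Submodule.smul_mem _ (⟨a.1, h a.2⟩ : F') hx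

theorem di_sup_span' [Algebra.IsAlgebraic k K] (F M : IntermediateField k K) {x : K}
    (hx : x ∈ F ⊔ M) : x ∈ Submodule.span F (M : Set K) := by
  apply di_sup_span F M.toSubfield.toSubmonoid
  convert hx
  exact adjoin_self k M

theorem di_relfinrank_le {F E : IntermediateField k K} (h : F ≤ E) (b : Finset K)
    (hb : ∀ x ∈ E, x ∈ Submodule.span F (b : Set K)) :
    0 < relfinrank F E ∧ relfinrank F E ≤ b.card := by
  rw [relfinrank_eq_finrank_of_le h]
  have hle : (extendScalars h).toSubalgebra.toSubmodule ≤ Submodule.span F (b : Set K) := hb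
  have : Module.Finite F (Submodule.span F (b : Set K)) :=
    FiniteDimensional.span_finset F b
  have hfin : Module.Finite F (extendScalars h).toSubalgebra.toSubmodule :=
    Submodule.finiteDimensional_of_le hle
  have hfin' : Module.Finite F (extendScalars h) := hfin
  refine ⟨Module.finrank_pos, ?_⟩
  exact (Submodule.finrank_mono hle).trans (finrank_span_finset_le_card b)

theorem di_relfinrank_exists {F E : IntermediateField k K} (h : F ≤ E) (T : Set K)
    (hT : T ⊆ E) (hE : ∀ x ∈ E, x ∈ Submodule.span F T) (hpos : 0 < relfinrank F E) :
    ∃ b : Finset K, (b : Set K) ⊆ T ∧ b.card = relfinrank F E ∧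
      ∀ x ∈ E, x ∈ Submodule.span F (b : Set K) := by
  rw [relfinrank_eq_finrank_of_le h] at hpos ⊢
  have hspan : Submodule.span F T = (extendScalars h).toSubalgebra.toSubmodule := by
    apply le_antisymm
    · exact Submodule.span_le.2 hT
    · exact hE
  obtain ⟨b, hbT, hbs, hli⟩ := exists_linearIndependent F T
  have hfin : Module.Finite F (extendScalars h) := Module.finite_of_finrank_pos hpos
  have hfin' : Module.Finite F (Submodule.span F b) := by
    rw [hbs, hspan]; exact hfin
  have hbf : b.Finite := by
    have hfin2 : Module.Finite F (Submodule.span F (Set.range ((↑) : b → K))) := by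
      rw [Subtype.range_coe]; exact hfin'
    have h2 := (Module.Basis.span hli).linearIndependent
    have : Finite b := h2.finite
    exact b.toFinite
  have : Fintype b := hbf.fintype
  refine ⟨hbf.toFinset, by simpa using hbT, ?_, ?_⟩
  · have h3 := finrank_span_set_eq_card hli
    rw [hbs, hspan] at h3
    rw [Set.Finite.toFinset_eq_toFinset, ← h3]
    rfl
  · intro x hx
    simpa [hbs] using hE x hx

theorem di_lemB [Algebra.IsAlgebraic k K] (A : IntermediateField k K) {X Y : IntermediateField k K}
    (h : X ≤ Y) (hpos : 0 < relfinrank X Y) :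
    0 < relfinrank (A ⊔ X) (A ⊔ Y) ∧ relfinrank (A ⊔ X) (A ⊔ Y) ≤ relfinrank X Y := by
  obtain ⟨b, hbY, hbc, hb⟩ := di_relfinrank_exists h Y subset_rfl
    (fun x hx => Submodule.subset_span hx) hpos
  rw [← hbc]
  refine di_relfinrank_le (sup_le_sup_left h A) b ?_
  intro x hx
  have hx' : x ∈ (A ⊔ X) ⊔ Y := by rwa [sup_assoc, sup_eq_right.2 h]
  have h1 := di_sup_span' _ _ hx'
  have h2 : Submodule.span (↥(A ⊔ X)) (Y : Set K) ≤ Submodule.span (↥(A ⊔ X)) (b : Set K) := by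
    rw [Submodule.span_le]
    intro y hy
    exact di_span_mono le_sup_right (hb y hy)
  exact h2 h1

theorem di_lemA [Algebra.IsAlgebraic k K] {ι : Type*} [Preorder ι] [IsDirectedOrder ι] [Nonempty ι]
    (A : ι → IntermediateField k K) (hA : Monotone A) {X M : IntermediateField k K} (h : X ≤ M)
    [FiniteDimensional k M] :
    ∃ i₀, ∀ i, i₀ ≤ i → relfinrank (A i ⊔ X) (A i ⊔ M) = relfinrank ((⨆ i, A i) ⊔ X) ((⨆ i, A i) ⊔ M) := by
  have hpos : 0 < relfinrank X M :=
    Nat.pos_of_ne_zero fun h0 => by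
      have := relfinrank_dvd_finrank_bot (A := X) (B := M)
      rw [h0, zero_dvd_iff] at this
      exact Module.finrank_pos.ne' this
  set S := ⨆ i, A i with hS
  have hd : Directed (· ≤ ·) A := hA.directed_le
  have hd' : Directed (· ≤ ·) (fun i => A i ⊔ X) :=
    Monotone.directed_le fun i j hij => sup_le_sup_right (hA hij) X
  have hSX : S ⊔ X = ⨆ i, (A i ⊔ X) := by rw [iSup_sup]
  have hSM : S ⊔ M = (S ⊔ X) ⊔ M := by rw [sup_assoc, sup_eq_right.2 h]
  obtain ⟨b, hbM, hbc, hb⟩ := di_relfinrank_exists (sup_le_sup_left h S) M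
    (fun x hx => (le_sup_right : M ≤ S ⊔ M) hx)
    (fun x hx => di_sup_span' _ _ (hSM ▸ hx)) (di_lemB S h hpos).1
  -- descent
  have key : ∀ x : K, x ∈ Submodule.span ↥(S ⊔ X) (b : Set K) →
      ∃ i, x ∈ Submodule.span ↥(A i ⊔ X) (b : Set K) := by
    intro x hx
    induction hx using Submodule.span_induction with
    | mem x hx => exact ⟨Classical.arbitrary ι, Submodule.subset_span hx⟩
    | zero => exact ⟨Classical.arbitrary ι, Submodule.zero_mem _⟩
    | add x y _ _ h1 h2 =>
      obtain ⟨i, hi⟩ := h1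
      obtain ⟨j, hj⟩ := h2
      obtain ⟨l, hil, hjl⟩ := exists_ge_ge i j
      exact ⟨l, Submodule.add_mem _ (di_span_mono (sup_le_sup_right (hA hil) X) hi)
        (di_span_mono (sup_le_sup_right (hA hjl) X) hj)⟩
    | smul a x _ hx =>
      obtain ⟨i, hi⟩ := hx
      have ha : (a : K) ∈ ((⨆ i, (A i ⊔ X) : IntermediateField k K) : Set K) := by
        rw [← hSX]; exact a.2
      rw [coe_iSup_of_directed hd', Set.mem_iUnion] at ha
      obtain ⟨j, hj⟩ := ha
      obtain ⟨l, hil, hjl⟩ := exists_ge_ge i j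
      exact ⟨l, Submodule.smul_mem _ (⟨a.1, (sup_le_sup_right (hA hjl) X) hj⟩ : ↥(A l ⊔ X))
        (di_span_mono (sup_le_sup_right (hA hil) X) hi)⟩
  have key2 : ∀ s : Finset K, (∀ x ∈ s, x ∈ Submodule.span ↥(S ⊔ X) (b : Set K)) →
      ∃ i, ∀ x ∈ s, x ∈ Submodule.span ↥(A i ⊔ X) (b : Set K) := by
    classical
    intro s
    induction s using Finset.induction_on with
    | empty => intro _; exact ⟨Classical.arbitrary ι, by simp⟩
    | insert a s _ ih =>
      intro hs
      obtain ⟨i, hi⟩ := ih fun x hx => hs x (Finset.mem_insert_of_mem hx)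
      obtain ⟨j, hj⟩ := key a (hs a (Finset.mem_insert_self _ _))
      obtain ⟨l, hil, hjl⟩ := exists_ge_ge i j
      refine ⟨l, fun x hx => ?_⟩
      rcases Finset.mem_insert.1 hx with rfl | hx
      · exact di_span_mono (sup_le_sup_right (hA hjl) X) hj
      · exact di_span_mono (sup_le_sup_right (hA hil) X) (hi x hx)
  have hMfg : (Subalgebra.toSubmodule M.toSubalgebra).FG := by
    rw [← Module.Finite.iff_fg]
    exact (inferInstance : Module.Finite k M)
  obtain ⟨m, hm⟩ := hMfg
  obtain ⟨i₀, hi₀⟩ := key2 m (fun x hx => hb x ((le_sup_right : M ≤ S ⊔ M) (by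
    have : x ∈ Subalgebra.toSubmodule M.toSubalgebra := hm ▸ Submodule.subset_span hx
    exact this)))
  refine ⟨i₀, fun i hi => le_antisymm ?_ ?_⟩
  · rw [← hbc]
    refine (di_relfinrank_le (sup_le_sup_left h (A i)) b ?_).2
    intro x hx
    have hx' : x ∈ (A i ⊔ X) ⊔ M := by rwa [sup_assoc, sup_eq_right.2 h]
    have h1 := di_sup_span' _ _ hx'
    refine Submodule.span_le.2 ?_ h1
    intro y hy
    have hy' : y ∈ Submodule.span k (m : Set K) := by rw [hm]; exact hy
    have h3 : Submodule.span k (m : Set K) ≤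
        (Submodule.span ↥(A i ⊔ X) (b : Set K)).restrictScalars k := by
      rw [Submodule.span_le]
      intro z hz
      exact di_span_mono (sup_le_sup_right (hA hi) X) (hi₀ z hz)
    exact h3 hy'
  · have h4 := (di_lemB S (sup_le_sup_left h (A i)) (di_lemB (A i) h hpos).1).2
    have h5 : A i ≤ S := le_iSup A i
    rwa [← sup_assoc, ← sup_assoc, sup_eq_left.2 h5] at h4
end RelLemmas
section FrobLemmas
variable {k K : Type*} [Field k] [Field K] [Algebra k K]

theorem di_pos_of_fin (X M : IntermediateField k K) [FiniteDimensional k M] :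
    0 < relfinrank X M :=
  Nat.pos_of_ne_zero fun h0 => by
    have := relfinrank_dvd_finrank_bot (A := X) (B := M)
    rw [h0, zero_dvd_iff] at this
    exact Module.finrank_pos.ne' this

/-- The elements whose `p`-th power lies in `C`. -/
def diRoot (p : ℕ) [Fact p.Prime] [CharP K p] (C : IntermediateField k K) : IntermediateField k K where
  carrier := {y | y ^ p ∈ C}
  mul_mem' := by
    intro a b ha hb
    simp only [Set.mem_setOf_eq, mul_pow] at *
    exact mul_mem ha hb
  add_mem' := by
    intro a b ha hb
    simp only [Set.mem_setOf_eq, add_pow_char] at *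
    exact add_mem ha hb
  algebraMap_mem' := fun r => pow_mem (C.algebraMap_mem r) p
  inv_mem' := by
    intro a ha
    simp only [Set.mem_setOf_eq, inv_pow] at *
    exact inv_mem ha

variable (p : ℕ) [Fact p.Prime] [CharP K p]

theorem di_pC_gc : GaloisConnection (pClosureOf p : IntermediateField k K → IntermediateField k K)
    (diRoot p) := by
  intro M C
  constructor
  · intro h y hy
    exact h (subset_adjoin k _ ⟨y, hy, rfl⟩)
  · intro h
    refine adjoin_le_iff.2 ?_
    rintro _ ⟨y, hy, rfl⟩
    exact h hy


theorem di_pC_le (M : IntermediateField k K) : pClosureOf p M ≤ M := by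
  refine adjoin_le_iff.2 ?_
  rintro _ ⟨y, hy, rfl⟩
  exact pow_mem hy p

theorem di_rel_pC [Algebra.IsAlgebraic k K] {N M : IntermediateField k K} (h : N ≤ M)
    (hpos : 0 < relfinrank N M) :
    relfinrank (pClosureOf p N) (pClosureOf p M) ≤ relfinrank N M := by
  classical
  obtain ⟨b, hbM, hbc, hb⟩ := di_relfinrank_exists h M subset_rfl
    (fun x hx => Submodule.subset_span hx) hpos
  have hle : pClosureOf p N ≤ pClosureOf p M := (di_pC_gc p).monotone_l h
  refine ((di_relfinrank_le hle (b.image (· ^ p)) ?_).2.trans Finset.card_image_le).trans hbc.le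
  intro x hx
  have hT : pClosureOf p M = adjoin k ((M.toSubfield.toSubmonoid.map (powMonoidHom p) : Submonoid K) : Set K) := by
    rw [pClosureOf]
    congr 1
  have hx' : x ∈ pClosureOf p N ⊔ adjoin k ((M.toSubfield.toSubmonoid.map (powMonoidHom p) : Submonoid K) : Set K) := by
    rw [← hT]
    exact (le_sup_right : pClosureOf p M ≤ _) hx
  refine Submodule.span_le.2 ?_ (di_sup_span _ _ hx')
  rintro _ ⟨y, hy, rfl⟩
  have hy' := hb y hy
  clear hy
  induction hy' using Submodule.span_induction with
  | mem x hx =>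
    exact Submodule.subset_span (by
      simp only [Finset.coe_image, powMonoidHom_apply]
      exact ⟨x, hx, rfl⟩)
  | zero =>
    simp only [powMonoidHom_apply, zero_pow (Fact.out : p.Prime).ne_zero]
    exact Submodule.zero_mem _
  | add x y _ _ h1 h2 =>
    simp only [powMonoidHom_apply, add_pow_char] at *
    exact Submodule.add_mem _ h1 h2
  | smul a x _ hx =>
    have : (powMonoidHom p) (a • x) =
      (⟨a.1 ^ p, subset_adjoin k _ ⟨a.1, a.2, rfl⟩⟩ : ↥(pClosureOf p N)) • (powMonoidHom p) x := by
      simp [Algebra.smul_def, mul_pow]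
    rw [this]
    exact Submodule.smul_mem _ _ hx

theorem di_P1 [Algebra.IsAlgebraic k K] {N M : IntermediateField k K} (h : N ≤ M)
    [FiniteDimensional k M] :
    relfinrank (pClosureOf p N) N ≤ relfinrank (pClosureOf p M) M := by
  have hpos := di_pos_of_fin N M
  have h1 := di_rel_pC p h hpos
  have h2 := relfinrank_mul_relfinrank (di_pC_le p N) h
  have h3 := relfinrank_mul_relfinrank ((di_pC_gc p).monotone_l h) (di_pC_le p M)
  refine Nat.le_of_mul_le_mul_right (c := relfinrank N M) ?_ hpos
  rw [h2, ← h3, mul_comm]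
  exact Nat.mul_le_mul_left _ h1

end FrobLemmas
section RB
variable {G E : Type*} [Field G] [Field E] [Algebra G E] (p : ℕ) [Fact p.Prime] [CharP E p]

theorem di_C1 {S : Set E} {x : E} (hx : x ∉ adjoin G S) (hxp : x ^ p ∈ adjoin G S) :
    relfinrank (adjoin G S) (adjoin G (insert x S)) = p := by
  have hle : adjoin G S ≤ adjoin G (insert x S) := adjoin.mono _ _ _ (Set.subset_insert x S)
  set A := adjoin G S with hA
  rw [relfinrank_eq_finrank_of_le hle]
  have h1 : extendScalars hle = adjoin A {x} := by
    apply restrictScalars_injective G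
    rw [extendScalars_restrictScalars, hA, adjoin_adjoin_left, Set.union_singleton]
  rw [h1]
  have hp : p.Prime := Fact.out
  let a : A := ⟨x ^ p, hxp⟩
  have hirr : Irreducible (Polynomial.X ^ p - Polynomial.C a) := by
    apply X_pow_sub_C_irreducible_of_prime hp
    intro b hb
    apply hx
    have h2 : (b : E) ^ p = x ^ p := by
      have := congrArg (Subtype.val) hb
      simpa using this
    have h3 : (b : E) = x := frobenius_inj E p (by simpa [frobenius_def] using h2)
    rw [← h3]; exact b.2
  have hmonic : (Polynomial.X ^ p - Polynomial.C a).Monic := Polynomial.monic_X_pow_sub_C a hp.ne_zero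
  have hroot : Polynomial.aeval x (Polynomial.X ^ p - Polynomial.C a) = 0 := by
    simp [a, Subtype.coe_mk, IntermediateField.algebraMap_apply]
  have hmin := minpoly.eq_of_irreducible_of_monic hirr hroot hmonic
  have hint : IsIntegral A x := ⟨_, hmonic, by simpa [Polynomial.aeval_def] using hroot⟩
  rw [adjoin.finrank hint, ← hmin, Polynomial.natDegree_X_pow_sub_C]

theorem di_C2 (hE : ∀ x : E, x ^ p ∈ (⊥ : IntermediateField G E)) (B : Finset E)
    (hB : ∀ x ∈ (B : Set E), x ∉ adjoin G ((B : Set E) \ {x})) :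
    Module.finrank G (adjoin G (B : Set E)) = p ^ B.card := by
  classical
  induction B using Finset.induction_on with
  | empty => simp
  | insert a B ha ih =>
    have ih' := ih (fun x hx hx' => hB x (by simp [Finset.mem_coe.1 hx]) (adjoin.mono _ _ _ (by
      intro y hy; exact ⟨by simp [Finset.mem_coe.1 hy.1], hy.2⟩) hx'))
    have hna : a ∉ adjoin G (B : Set E) := by
      have := hB a (by simp)
      have h2 : ((insert a B : Finset E) : Set E) \ {a} = B := by
        ext y
        simp only [Finset.coe_insert, Set.mem_diff, Set.mem_insert_iff, Finset.mem_coe,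
          Set.mem_singleton_iff]
        constructor
        · tauto
        · intro hy; exact ⟨Or.inr hy, fun h => ha (h ▸ hy)⟩
      rwa [h2] at this
    have h1 := di_C1 p hna ((bot_le : (⊥ : IntermediateField G E) ≤ _) (hE a))
    have h2 := finrank_bot_mul_relfinrank (F := G)
      (adjoin.mono G _ _ (Set.subset_insert a (B : Set E)))
    rw [Finset.coe_insert, ← h2, h1, ih', Finset.card_insert_of_notMem ha, pow_succ]

theorem di_C3 (hE : ∀ x : E, x ^ p ∈ (⊥ : IntermediateField G E)) :
    ∃ B : Set E, adjoin G B = ⊤ ∧ ∀ x ∈ B, x ∉ adjoin G (B \ {x}) := by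
  classical
  obtain ⟨B, hB⟩ := zorn_subset {B : Set E | ∀ x ∈ B, x ∉ adjoin G (B \ {x})} (by
    intro c hc hchain
    refine ⟨⋃₀ c, ?_, fun s hs => Set.subset_sUnion_of_mem hs⟩
    intro x hx hx'
    obtain ⟨T, hT, hxT⟩ := exists_finset_of_mem_adjoin hx'
    have hne : c.Nonempty := by
      obtain ⟨s, hs, _⟩ := hx; exact ⟨s, hs⟩
    obtain ⟨s, hs, hsub⟩ := hchain.directedOn.exists_mem_subset_of_finite_of_subset_sUnion hne
      (s := insert x (T : Set E)) (T.finite_toSet.insert x)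
      (Set.insert_subset hx (fun y hy => (hT hy).1))
    refine hc hs x (hsub (Set.mem_insert _ _)) (adjoin.mono _ _ _ ?_ hxT)
    intro y hy
    exact ⟨hsub (Set.mem_insert_of_mem _ hy), (hT hy).2⟩)
  refine ⟨B, ?_, hB.prop⟩
  by_contra hne
  obtain ⟨y, hy⟩ : ∃ y, y ∉ adjoin G B := by
    by_contra! h
    exact hne (eq_top_iff.2 fun y _ => h y)
  have hyB : y ∉ B := fun h => hy (subset_adjoin _ _ h)
  have hnf : ¬ (∀ x ∈ insert y B, x ∉ adjoin G (insert y B \ {x})) := by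
    intro hf
    exact hyB (hB.le_of_ge (y := insert y B) hf (Set.subset_insert y B) (Set.mem_insert y B))
  push Not at hnf
  obtain ⟨x, hx, hx'⟩ := hnf
  rcases Set.mem_insert_iff.1 hx with rfl | hxB
  · apply hy
    refine adjoin.mono _ _ _ ?_ hx'
    rintro z ⟨hz, hzx⟩
    exact (Set.mem_insert_iff.1 hz).resolve_left hzx
  · set S := B \ {x} with hS
    have hxS : x ∉ adjoin G S := hB.prop x hxB
    have hBS : B = insert x S := by
      rw [hS, Set.insert_diff_singleton, Set.insert_eq_of_mem hxB]
    have hxy : x ∈ adjoin G (insert y S) := by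
      refine adjoin.mono _ _ _ ?_ hx'
      rintro z ⟨hz, hzx⟩
      rcases Set.mem_insert_iff.1 hz with rfl | hz
      · exact Set.mem_insert _ _
      · exact Set.mem_insert_of_mem _ ⟨hz, hzx⟩
    have hyS : y ∉ adjoin G S := fun h => hy (adjoin.mono _ _ _ Set.diff_subset h)
    have hbot : ∀ z : E, z ^ p ∈ adjoin G S := fun z => (bot_le : ⊥ ≤ adjoin G S) (hE z)
    have r1 := di_C1 p hxS (hbot x)
    have r2 := di_C1 p hyS (hbot y)
    have hle1 : adjoin G S ≤ adjoin G (insert x S) := adjoin.mono _ _ _ (Set.subset_insert x S)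
    have hle2 : adjoin G (insert x S) ≤ adjoin G (insert y S) :=
      adjoin_le_iff.2 (Set.insert_subset hxy
        ((Set.subset_insert y S).trans (subset_adjoin G _)))
    have r3 := relfinrank_mul_relfinrank hle1 hle2
    rw [r1, r2] at r3
    have r4 : relfinrank (adjoin G (insert x S)) (adjoin G (insert y S)) = 1 :=
      Nat.eq_of_mul_eq_mul_left (Fact.out : p.Prime).pos (by rw [r3, mul_one])
    rw [relfinrank_eq_one_iff] at r4
    apply hy
    rw [hBS]
    exact r4 (subset_adjoin G _ (Set.mem_insert _ _))

theorem di_C4 (h : diCard G E p < Cardinal.aleph0) :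
    ∃ B : Finset E, diCard G E p = B.card ∧ adjoin (pClosure G E p) (B : Set E) = ⊤ ∧
      Module.finrank (pClosure G E p) E = p ^ B.card := by
  have hE : ∀ x : E, x ^ p ∈ (⊥ : IntermediateField (pClosure G E p) E) := by
    intro x
    rw [mem_bot]
    exact ⟨⟨x ^ p, subset_adjoin G _ ⟨x, rfl⟩⟩, rfl⟩
  obtain ⟨B₀, hB₀⟩ := di_C3 (G := pClosure G E p) p hE
  obtain ⟨B, hB, hBc⟩ := csInf_mem (s := {c : Cardinal | ∃ B : Set E, RBasis G E p B ∧ Cardinal.mk B = c})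
    ⟨_, B₀, hB₀, rfl⟩
  have hBc' : Cardinal.mk B = diCard G E p := hBc
  rw [← hBc'] at h ⊢
  have hfin : B.Finite := Cardinal.lt_aleph0_iff_set_finite.1 h
  obtain ⟨B, rfl⟩ := hfin.exists_finset_coe
  refine ⟨B, by simp, hB.1, ?_⟩
  rw [← di_C2 (G := pClosure G E p) p hE B hB.2, hB.1]
  exact (IntermediateField.finrank_top' ).symm

theorem di_iter_le (n : ℕ) : ∀ (M C : IntermediateField G E), (∀ y ∈ M, y ^ p ^ n ∈ C) →
    (pClosureOf p)^[n] M ≤ C := by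
  induction n with
  | zero => intro M C h y hy; simpa using h y hy
  | succ n ih =>
    intro M C h
    rw [Function.iterate_succ_apply']
    refine (di_pC_gc p _ _).2 (ih M _ ?_)
    intro y hy
    change (y ^ p ^ n) ^ p ∈ C
    rw [← pow_mul, ← pow_succ]
    exact h y hy

theorem di_C5 (h : diCard G E p < Cardinal.aleph0) (n : ℕ)
    (hn : ∀ x : E, x ^ p ^ n ∈ (⊥ : IntermediateField G E)) [Algebra.IsAlgebraic G E] :
    FiniteDimensional G E := by
  obtain ⟨B, -, hB, -⟩ := di_C4 p h
  set H := adjoin G (B : Set E) with hH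
  have hfd : FiniteDimensional G H := by
    exact finiteDimensional_adjoin fun x _ => Algebra.IsIntegral.isIntegral x
  have hpc : pClosure G E p = pClosureOf p ⊤ := by
    simp [pClosure, pClosureOf]
  have h1 : pClosureOf p ⊤ ⊔ H = ⊤ := by
    have := congrArg (restrictScalars G) hB
    rw [restrictScalars_adjoin_eq_sup, hpc] at this
    simpa using this
  have h2 : ∀ j : ℕ, (pClosureOf p)^[j] ⊤ ⊔ H = ⊤ := by
    intro j
    induction j with
    | zero => simp
    | succ j ih =>
      rw [Function.iterate_succ_apply']
      have h3 : pClosureOf p ((pClosureOf p)^[j] ⊤ ⊔ H) ⊔ H = ⊤ := by rw [ih, h1]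
      rw [(di_pC_gc p).l_sup, sup_assoc, sup_eq_right.2 (di_pC_le p H)] at h3
      exact h3
  have h3 := h2 n
  have h4 : (pClosureOf p)^[n] (⊤ : IntermediateField G E) ≤ ⊥ := di_iter_le p n _ _ fun y _ => hn y
  rw [sup_eq_right.2 (h4.trans bot_le)] at h3
  rw [h3] at hfd
  exact topEquiv.toLinearEquiv.finiteDimensional

end RB
section DiSup
variable {k K : Type*} [Field k] [Field K] [Algebra k K] (p : ℕ) [Fact p.Prime] [CharP K p]

theorem di_mem_root_iter (n : ℕ) : ∀ (C : IntermediateField k K) (x : K),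
    x ∈ (diRoot p)^[n] C ↔ x ^ p ^ n ∈ C := by
  induction n with
  | zero => intro C x; simp
  | succ n ih =>
    intro C x
    rw [Function.iterate_succ_apply']
    change x ^ p ∈ (diRoot p)^[n] C ↔ _
    rw [ih, ← pow_mul, ← pow_succ']

theorem di_mem_expleq (n : ℕ) (x : K) :
    x ∈ expleq k K p n ↔ x ^ p ^ n ∈ (⊥ : IntermediateField k K) := by
  constructor
  · intro h
    rw [← di_mem_root_iter]
    refine (adjoin_le_iff.2 ?_ : expleq k K p n ≤ (diRoot p)^[n] ⊥) h
    intro y hy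
    rw [SetLike.mem_coe, di_mem_root_iter, mem_bot]
    exact hy
  · intro h
    rw [mem_bot] at h
    exact subset_adjoin k _ h

theorem di_expleq_mono : Monotone (expleq k K p) := by
  intro m n h x hx
  rw [di_mem_expleq] at hx ⊢
  obtain ⟨c, rfl⟩ := Nat.exists_eq_add_of_le h
  rw [pow_add, pow_mul]
  exact pow_mem hx _


theorem di_bridge (M : IntermediateField k K) :
    relfinrank (pClosureOf p M) M = Module.finrank (pClosure k M p) M := by
  have h1 : pClosureOf p M = (pClosure k M p).map M.val := by
    rw [pClosure, adjoin_map, pClosureOf]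
    congr 1
    ext x
    constructor
    · rintro ⟨y, hy, rfl⟩
      exact ⟨⟨y, hy⟩ ^ p, ⟨⟨y, hy⟩, rfl⟩, rfl⟩
    · rintro ⟨_, ⟨y, rfl⟩, rfl⟩
      exact ⟨y.1, y.2, rfl⟩
  have h2 : (pClosure k M p) = (pClosureOf p M).comap M.val := by
    rw [h1, comap_map]
  conv_rhs => rw [h2]
  rw [finrank_comap, fieldRange_val]

theorem di_D (hK : ∀ x : K, ∃ n : ℕ, x ^ p ^ n ∈ (⊥ : IntermediateField k K))
    [Algebra.IsAlgebraic k K]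
    (h : di k K p < Cardinal.aleph0) :
    ∃ d : ℕ, di k K p = d ∧ ∃ M₀ : IntermediateField k K, FiniteDimensional k M₀ ∧
      ∀ M, M₀ ≤ M → FiniteDimensional k M → relfinrank (pClosureOf p M) M = p ^ d := by
  have hbdd : BddAbove (Set.range fun n => diCard k (expleq k K p n) p) := Cardinal.bddAbove_range _
  have hle : ∀ n, diCard k (expleq k K p n) p ≤ di k K p := fun n => le_ciSup hbdd n
  have hlt : ∀ n, diCard k (expleq k K p n) p < Cardinal.aleph0 := fun n => (hle n).trans_lt h
  have hfd : ∀ n, FiniteDimensional k (expleq k K p n) := by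
    intro n
    refine di_C5 p (hlt n) n ?_
    intro x
    have := (di_mem_expleq p n x.1).1 x.2
    rw [mem_bot] at this ⊢
    obtain ⟨a, ha⟩ := this
    exact ⟨a, Subtype.ext ha⟩
  have hB : ∀ n, ∃ d : ℕ, diCard k (expleq k K p n) p = d ∧
      relfinrank (pClosureOf p (expleq k K p n)) (expleq k K p n) = p ^ d := by
    intro n
    obtain ⟨B, h1, -, h2⟩ := di_C4 p (hlt n)
    exact ⟨B.card, h1, by rw [di_bridge, h2]⟩
  choose d hd hd' using hB
  obtain ⟨D, hD⟩ := Cardinal.lt_aleph0.1 h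
  have hdD : ∀ n, d n ≤ D := by
    intro n
    have := hle n
    rw [hd, hD] at this
    exact_mod_cast this
  have hex : ∃ n, d n = D := by
    by_contra! hne
    have hlt' : ∀ n, d n < D := fun n => lt_of_le_of_ne (hdD n) (hne n)
    have h5 : di k K p ≤ ((D - 1 : ℕ) : Cardinal) := by
      refine ciSup_le' fun n => ?_
      rw [hd]
      exact_mod_cast Nat.le_sub_one_of_lt (hlt' n)
    rw [hD] at h5
    have h6 : D ≤ D - 1 := by exact_mod_cast h5
    have := hlt' 0
    omega
  obtain ⟨n₀, hn₀⟩ := hex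
  refine ⟨D, hD, expleq k K p n₀, hfd n₀, ?_⟩
  intro M hM hMfd
  have hp := (Fact.out : p.Prime)
  refine le_antisymm ?_ ?_
  · obtain ⟨n, hn⟩ : ∃ n, M ≤ expleq k K p n := by
      have hMfg : (Subalgebra.toSubmodule M.toSubalgebra).FG := by
        rw [← Module.Finite.iff_fg]
        exact (inferInstance : Module.Finite k M)
      obtain ⟨m, hm⟩ := hMfg
      choose e he using hK
      refine ⟨m.sup e, fun x hx => ?_⟩
      have hx' : x ∈ Submodule.span k (m : Set K) := by rw [hm]; exact hx
      have : Submodule.span k (m : Set K) ≤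
          Subalgebra.toSubmodule (expleq k K p (m.sup e)).toSubalgebra := by
        rw [Submodule.span_le]
        intro y hy
        exact di_expleq_mono p (Finset.le_sup (f := e) hy) ((di_mem_expleq p _ y).2 (he y))
      exact this hx'
    have := hfd n
    calc _ ≤ _ := di_P1 p hn
      _ = p ^ d n := hd' n
      _ ≤ p ^ D := Nat.pow_le_pow_right hp.pos (hdD n)
  · rw [← hn₀, ← hd' n₀]
    exact di_P1 p hM

end DiSup
section LD
variable {k K : Type*} [Field k] [Field K] [Algebra k K]

theorem di_LD_iff [Algebra.IsAlgebraic k K] {C A B : IntermediateField k K} (hA : C ≤ A) (hB : C ≤ B)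
    (hpos : 0 < relfinrank C B) :
    (extendScalars hA).LinearDisjoint (extendScalars hB) ↔
      relfinrank A (A ⊔ B) = relfinrank C B := by
  have hAB : A ≤ A ⊔ B := le_sup_left
  have hle := di_lemB A hB hpos
  rw [sup_eq_left.2 hA] at hle
  have e1 := relfinrank_eq_finrank_of_le hB
  have e2 := relfinrank_eq_finrank_of_le hAB
  have hfB : Module.Finite C (extendScalars hB) := Module.finite_of_finrank_pos (e1 ▸ hpos)
  have hfAB : Module.Finite A (extendScalars hAB) := Module.finite_of_finrank_pos (e2 ▸ hle.1)
  let b := Module.finBasis C (extendScalars hB)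
  let v : Fin (Module.finrank C (extendScalars hB)) → extendScalars hAB :=
    fun i => ⟨(b i : K), (le_sup_right : B ≤ A ⊔ B) (b i).2⟩
  have hv : LinearIndependent A v ↔ LinearIndependent A (fun i => ((b i : K))) := by
    have := LinearMap.linearIndependent_iff (extendScalars hAB).val.toLinearMap (v := v)
      (LinearMap.ker_eq_bot.2 Subtype.val_injective)
    exact this.symm
  constructor
  · intro H
    refine le_antisymm hle.2 ?_
    have h1 : LinearIndependent (extendScalars hA) (fun i => ((b i : K))) :=
      H.linearIndependent_right b.linearIndependent
    have h2 : LinearIndependent A v := hv.2 h1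
    have := h2.fintype_card_le_finrank
    rw [Fintype.card_fin] at this
    rw [e1, e2]
    exact this
  · intro H
    rw [e1, e2] at H
    have h2 : LinearIndependent A v := by
      apply linearIndependent_of_top_le_span_of_card_eq_finrank
      · intro x _
        have hx := di_sup_span' A B x.2
        have hx2 : (x : K) ∈ Submodule.span A (Set.range fun i => ((b i : K))) := by
          refine Submodule.span_le.2 ?_ hx
          intro y hy
          apply di_span_mono hA
          have h3 := b.mem_span ⟨y, hy⟩
          have h4 := Submodule.mem_map_of_mem (f := (extendScalars hB).val.toLinearMap) h3
          rw [Submodule.map_span, ← Set.range_comp] at h4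
          exact h4
        have h5 : Submodule.span A (Set.range fun i => ((b i : K))) =
            (Submodule.span A (Set.range v)).map (extendScalars hAB).val.toLinearMap := by
          rw [Submodule.map_span, ← Set.range_comp]
          rfl
        rw [h5] at hx2
        obtain ⟨z, hz, hzx⟩ := hx2
        have : z = x := Subtype.ext hzx
        rwa [← this]
      · rw [Fintype.card_fin, H]
    exact LinearDisjoint.of_basis_right b (hv.1 h2)

theorem di_LD_iSup {ι : Type*} [Preorder ι] [IsDirectedOrder ι] [Nonempty ι]
    {C A B : IntermediateField k K} (hA : C ≤ A) (hB : C ≤ B)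
    (D : ι → IntermediateField k K) (hmono : Monotone D) (hD : ∀ i, C ≤ D i) (hsup : B = ⨆ i, D i)
    (H : ∀ i, (extendScalars hA).LinearDisjoint (extendScalars (hD i))) :
    (extendScalars hA).LinearDisjoint (extendScalars hB) := by
  classical
  let a := Module.Basis.ofVectorSpace C (extendScalars hA)
  refine LinearDisjoint.of_basis_left a ?_
  rw [linearIndependent_iff']
  intro s g hg
  have key : ∀ t : Finset _, ∃ i, ∀ j ∈ t, (g j : K) ∈ D i := by
    intro t
    induction t using Finset.induction_on with
    | empty => exact ⟨Classical.arbitrary ι, by simp⟩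
    | insert j t _ ih =>
      obtain ⟨i, hi⟩ := ih
      have hBle : B ≤ ⨆ i, D i := hsup.le
      have hgj : (g j : K) ∈ ((⨆ i, D i : IntermediateField k K) : Set K) := hBle (g j).2
      rw [coe_iSup_of_directed hmono.directed_le, Set.mem_iUnion] at hgj
      obtain ⟨i', hi'⟩ := hgj
      obtain ⟨l, h1, h2⟩ := exists_ge_ge i i'
      refine ⟨l, fun x hx => ?_⟩
      rcases Finset.mem_insert.1 hx with rfl | hx
      · exact hmono h2 hi'
      · exact hmono h1 (hi x hx)
  obtain ⟨i, hi⟩ := key s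
  have h1 := (H i).linearIndependent_left a.linearIndependent
  rw [linearIndependent_iff'] at h1
  intro j hj
  have h2 := h1 s (fun j => if h : j ∈ s then ⟨(g j : K), hi j h⟩ else 0) (by
    rw [← hg]
    refine Finset.sum_congr rfl fun x hx => ?_
    simp only [hx, dite_true]
    rfl) j hj
  simp only [hj, dite_true] at h2
  have h3 : (g j : K) = 0 := congrArg (fun z : extendScalars (hD i) => (z : K)) h2
  exact Subtype.ext h3

end LD
section Core
variable {k K : Type*} [Field k] [Field K] [Algebra k K] (p : ℕ) [Fact p.Prime] [CharP K p]
  [Algebra.IsAlgebraic k K]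

theorem di_fd_of_le {A B : IntermediateField k K} (h : A ≤ B) [FiniteDimensional k B] :
    FiniteDimensional k A :=
  Module.Finite.of_injective (inclusion h).toLinearMap (inclusion_injective h)

theorem di_core_arith {u v w b : ℕ} (h : v * u = b * w) (hw : w ≤ v) (hv : 0 < v) (hb : 0 < b) :
    u ≤ b ∧ (u = b ↔ w = v) := by
  refine ⟨le_of_mul_le_mul_left (a := v) ?_ hv, ?_, ?_⟩
  · rw [h, mul_comm]; exact Nat.mul_le_mul_right _ hw
  · rintro rfl
    exact (Nat.eq_of_mul_eq_mul_left hb (by rw [mul_comm, h])).symm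
  · rintro rfl
    exact Nat.eq_of_mul_eq_mul_left hv (by rw [h, mul_comm])

theorem di_core (L N₀ M : IntermediateField k K) (hN₀ : FiniteDimensional k N₀) (hN₀L : N₀ ≤ L)
    (hM : FiniteDimensional k M) (a b c : ℕ) (hb : 0 < b) (hc : 0 < c)
    (ha : ∀ M', M ≤ M' → FiniteDimensional k M' → relfinrank (pClosureOf p M') M' = a)
    (hbN : ∀ N, N₀ ≤ N → N ≤ L → FiniteDimensional k N → relfinrank (pClosureOf p N) N = b)
    (hcM : relfinrank (L ⊔ pClosureOf p M) (L ⊔ M) = c) :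
    a ≤ c * b ∧ (a = c * b ↔ relfinrank L (L ⊔ pClosureOf p M) =
      relfinrank (pClosureOf p L) (pClosureOf p L ⊔ pClosureOf p M)) := by
  let J := {N : IntermediateField k K // FiniteDimensional k N ∧ N₀ ≤ N ∧ N ≤ L}
  have : Nonempty J := ⟨⟨N₀, hN₀, le_rfl, hN₀L⟩⟩
  have : IsDirectedOrder J := ⟨fun x y => by
    have := x.2.1
    have := y.2.1
    exact ⟨⟨x.1 ⊔ y.1, inferInstance, x.2.2.1.trans le_sup_left, sup_le x.2.2.2 y.2.2.2⟩,
      (le_sup_left : x.1 ≤ _), (le_sup_right : y.1 ≤ _)⟩⟩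
  have hsup : (⨆ i : J, i.1) = L := by
    apply le_antisymm (iSup_le fun i => i.2.2.2)
    intro x hx
    have hfx : FiniteDimensional k k⟮x⟯ :=
      adjoin.finiteDimensional (Algebra.IsIntegral.isIntegral x)
    let i : J := ⟨N₀ ⊔ k⟮x⟯, inferInstance, le_sup_left, sup_le hN₀L (by simpa using hx)⟩
    exact (le_iSup (fun i : J => i.1) i) ((le_sup_right : k⟮x⟯ ≤ N₀ ⊔ k⟮x⟯)
      (mem_adjoin_simple_self k x))
  have hsup' : (⨆ i : J, pClosureOf p i.1) = pClosureOf p L := by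
    rw [← (di_pC_gc p).l_iSup, hsup]
  have mono1 : Monotone (fun i : J => i.1) := fun i j h => h
  have mono2 : Monotone (fun i : J => pClosureOf p i.1) := fun i j h => (di_pC_gc p).monotone_l h
  have hpM : FiniteDimensional k (pClosureOf p M) := di_fd_of_le (di_pC_le p M)
  obtain ⟨i1, h1⟩ := di_lemA (fun i : J => i.1) mono1 (di_pC_le p M)
  obtain ⟨i2, h2⟩ := di_lemA (fun i : J => i.1) mono1 (bot_le : ⊥ ≤ pClosureOf p M)
  obtain ⟨i3, h3⟩ := di_lemA (fun i : J => pClosureOf p i.1) mono2 (bot_le : ⊥ ≤ pClosureOf p M)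
  obtain ⟨j, hj1, hj2⟩ := exists_ge_ge i1 i2
  obtain ⟨i, hi1, hi2⟩ := exists_ge_ge j i3
  have h1 := h1 i (hj1.trans hi1)
  have h2 := h2 i (hj2.trans hi1)
  have h3 := h3 i hi2
  simp only [hsup, hsup', sup_bot_eq] at h1 h2 h3
  obtain ⟨N, hNf, hNN, hNL⟩ := i
  simp only at h1 h2 h3
  have hNM : FiniteDimensional k ↥(N ⊔ M) := inferInstance
  have ha' := ha (N ⊔ M) le_sup_right hNM
  have hb' := hbN N hNN hNL hNf
  rw [(di_pC_gc p).l_sup] at ha'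
  have t1 := relfinrank_mul_relfinrank (A := pClosureOf p N ⊔ pClosureOf p M)
    (B := N ⊔ pClosureOf p M) (C := N ⊔ M)
    (sup_le_sup_right (di_pC_le p N) _) (sup_le_sup_left (di_pC_le p M) _)
  have t2 := relfinrank_mul_relfinrank (A := pClosureOf p N)
    (B := pClosureOf p N ⊔ pClosureOf p M) (C := N ⊔ pClosureOf p M)
    le_sup_left (sup_le_sup_right (di_pC_le p N) _)
  have t3 := relfinrank_mul_relfinrank (A := pClosureOf p N) (B := N) (C := N ⊔ pClosureOf p M)
    (di_pC_le p N) le_sup_left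
  rw [h1, hcM, ha'] at t1
  rw [← t3, hb'] at t2
  have hpN : FiniteDimensional k (pClosureOf p N) := di_fd_of_le (di_pC_le p N)
  have hv : 0 < relfinrank (pClosureOf p N) (pClosureOf p N ⊔ pClosureOf p M) := di_pos_of_fin _ _
  have hwv : relfinrank N (N ⊔ pClosureOf p M) ≤
      relfinrank (pClosureOf p N) (pClosureOf p N ⊔ pClosureOf p M) := by
    have := (di_lemB N (le_sup_left : pClosureOf p N ≤ pClosureOf p N ⊔ pClosureOf p M) hv).2
    rwa [← sup_assoc, sup_eq_left.2 (di_pC_le p N)] at this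
  obtain ⟨hu, hiff⟩ := di_core_arith t2 hwv hv hb
  rw [h2, h3] at hiff
  rw [← hiff, ← t1, mul_comm]
  exact ⟨Nat.mul_le_mul_left _ hu, ⟨fun h => Nat.eq_of_mul_eq_mul_left hc h, fun h => by rw [h]⟩⟩

/-- Degree data for `L / k`, pushed into `K`. -/
theorem di_pC_map (L : IntermediateField k K) (N : IntermediateField k L) :
    pClosureOf p (N.map L.val) = (pClosureOf p N).map L.val := by
  rw [pClosureOf, pClosureOf, adjoin_map]
  congr 1
  ext x
  constructor
  · rintro ⟨_, ⟨y, hy, rfl⟩, rfl⟩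
    exact ⟨y ^ p, ⟨y, hy, rfl⟩, by simp⟩
  · rintro ⟨_, ⟨y, hy, rfl⟩, rfl⟩
    exact ⟨y, ⟨y, hy, rfl⟩, by simp⟩

theorem di_pC_ext (L M : IntermediateField k K) :
    (pClosureOf p (extendScalars (le_sup_left : L ≤ L ⊔ M))).restrictScalars k =
      L ⊔ pClosureOf p M := by
  apply le_antisymm
  · have : pClosureOf p (extendScalars (le_sup_left : L ≤ L ⊔ M)) ≤
        extendScalars (le_sup_left : L ≤ L ⊔ pClosureOf p M) := by
      refine adjoin_le_iff.2 ?_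
      rintro _ ⟨y, hy, rfl⟩
      have h1 : y ^ p ∈ pClosureOf p (L ⊔ M) := subset_adjoin k _ ⟨y, hy, rfl⟩
      rw [(di_pC_gc p).l_sup] at h1
      exact sup_le_sup_right (di_pC_le p L) (pClosureOf p M) h1
    exact this
  · refine sup_le ?_ (adjoin_le_iff.2 ?_)
    · intro y hy
      exact (pClosureOf p (extendScalars (le_sup_left : L ≤ L ⊔ M))).algebraMap_mem ⟨y, hy⟩
    · rintro _ ⟨y, hy, rfl⟩
      exact subset_adjoin L _ ⟨y, (le_sup_right : M ≤ L ⊔ M) hy, rfl⟩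

theorem di_relfinrank_ext (L M : IntermediateField k K) :
    relfinrank (pClosureOf p (extendScalars (le_sup_left : L ≤ L ⊔ M)))
      (extendScalars (le_sup_left : L ≤ L ⊔ M)) = relfinrank (L ⊔ pClosureOf p M) (L ⊔ M) := by
  rw [← di_pC_ext]
  rfl

end Core

section Final
variable {k K : Type*} [Field k] [Field K] [Algebra k K] (p : ℕ) [Fact p.Prime] [CharP K p]
  [Algebra.IsAlgebraic k K]

theorem di_final (hK : ∀ x : K, ∃ n : ℕ, x ^ p ^ n ∈ (⊥ : IntermediateField k K))
    (L : IntermediateField k K)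
    (hqK : di k K p < Cardinal.aleph0)
    (hqL : di k ↥L p < Cardinal.aleph0)
    (hqKL : di ↥L K p < Cardinal.aleph0)
    (hA : pClosureOf p L ≤ L) (hB : pClosureOf p L ≤ pClosure k K p) :
    di k K p ≤ di ↥L K p + di k ↥L p ∧
      (di k K p = di ↥L K p + di k ↥L p ↔
        (extendScalars hA).LinearDisjoint (extendScalars hB)) := by
  have hp : p.Prime := Fact.out
  have : CharP L p := charP_of_injective_algebraMap (algebraMap L K).injective p |> fun _ => by
    exact (algebraMap L K).charP (algebraMap L K).injective p
  obtain ⟨α, hα, M₀, hM₀, haM⟩ := di_D p hK hqK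
  obtain ⟨β, hβ, N₁, hN₁, hbN⟩ := di_D (k := k) (K := L) p (by
    intro x
    obtain ⟨n, hn⟩ := hK x.1
    refine ⟨n, ?_⟩
    rw [mem_bot] at hn ⊢
    obtain ⟨y, hy⟩ := hn
    exact ⟨y, Subtype.ext hy⟩) hqL
  obtain ⟨γ, hγ, M₁, hM₁, hcM⟩ := di_D (k := L) (K := K) p (by
    intro x
    obtain ⟨n, hn⟩ := hK x
    refine ⟨n, ?_⟩
    rw [mem_bot] at hn ⊢
    obtain ⟨y, hy⟩ := hn
    exact ⟨algebraMap k L y, hy⟩) hqKL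
  -- the subfield `N₀`
  have hbN' : ∀ N, N₁.map L.val ≤ N → N ≤ L → FiniteDimensional k N →
      relfinrank (pClosureOf p N) N = p ^ β := by
    intro N h1 h2 hf
    have e : (N.comap L.val).map L.val = N := by
      rw [map_comap_eq, fieldRange_val, inf_eq_left.2 h2]
    have hf' : FiniteDimensional k (N.comap L.val) := by
      have : FiniteDimensional k ((N.comap L.val).map L.val) := by rw [e]; exact hf
      exact (equivMap (N.comap L.val) L.val).symm.toLinearEquiv.finiteDimensional
    have := hbN (N.comap L.val) (map_le_iff_le_comap.1 h1) hf'
    rw [← this, ← relfinrank_map_map (f := L.val), ← di_pC_map, e]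
  have hN₀ : FiniteDimensional k (N₁.map L.val) :=
    (equivMap N₁ L.val).toLinearEquiv.finiteDimensional
  have hN₀L : N₁.map L.val ≤ L := by
    rw [map_le_iff_le_comap]
    intro x _
    exact x.2
  -- the subfield `M₁`
  obtain ⟨M₂, hM₂, hM₁₂⟩ : ∃ M₂ : IntermediateField k K, FiniteDimensional k M₂ ∧
      M₁ ≤ extendScalars (le_sup_left : L ≤ L ⊔ M₂) := by
    have hMfg : (Subalgebra.toSubmodule M₁.toSubalgebra).FG := by
      rw [← Module.Finite.iff_fg]
      exact (inferInstance : Module.Finite L M₁)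
    obtain ⟨m, hm⟩ := hMfg
    refine ⟨adjoin k (m : Set K), finiteDimensional_adjoin fun x _ => Algebra.IsIntegral.isIntegral x, ?_⟩
    intro x hx
    have hx' : x ∈ Submodule.span L (m : Set K) := by rw [hm]; exact hx
    have : Submodule.span L (m : Set K) ≤ Subalgebra.toSubmodule
        (extendScalars (le_sup_left : L ≤ L ⊔ adjoin k (m : Set K))).toSubalgebra := by
      rw [Submodule.span_le]
      intro y hy
      exact (le_sup_right : adjoin k (m : Set K) ≤ L ⊔ adjoin k (m : Set K)) (subset_adjoin k _ hy)
    exact this hx'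
  have hcM' : ∀ M, M₂ ≤ M → FiniteDimensional k M →
      relfinrank (L ⊔ pClosureOf p M) (L ⊔ M) = p ^ γ := by
    intro M h hf
    rw [← di_relfinrank_ext]
    refine hcM _ (hM₁₂.trans ?_) ?_
    · exact sup_le_sup_left h L
    · have h1 := (di_lemB L (bot_le : ⊥ ≤ M) (di_pos_of_fin _ _)).1
      rw [sup_bot_eq, relfinrank_eq_finrank_of_le (le_sup_left : L ≤ L ⊔ M)] at h1
      exact Module.finite_of_finrank_pos h1
  have hcore : ∀ M, M₀ ⊔ M₂ ≤ M → FiniteDimensional k M →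
      α ≤ γ + β ∧ (α = γ + β ↔ relfinrank L (L ⊔ pClosureOf p M) =
        relfinrank (pClosureOf p L) (pClosureOf p L ⊔ pClosureOf p M)) := by
    intro M h hf
    have := di_core p L (N₁.map L.val) M hN₀ hN₀L hf (p ^ α) (p ^ β) (p ^ γ) (pow_pos hp.pos _)
      (pow_pos hp.pos _) (fun M' h' hf' => haM M' ((le_sup_left.trans h).trans h') hf') hbN'
      (hcM' M (le_sup_right.trans h) hf)
    rw [← pow_add] at this
    rwa [Nat.pow_le_pow_iff_right hp.one_lt, Nat.pow_right_inj hp.two_le] at this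
  have hcond : ∀ M : IntermediateField k K, FiniteDimensional k M →
      ((extendScalars hA).LinearDisjoint (extendScalars
        (le_sup_left : pClosureOf p L ≤ pClosureOf p L ⊔ pClosureOf p M)) ↔
      relfinrank L (L ⊔ pClosureOf p M) =
        relfinrank (pClosureOf p L) (pClosureOf p L ⊔ pClosureOf p M)) := by
    intro M hf
    have hpM : FiniteDimensional k (pClosureOf p M) := di_fd_of_le (di_pC_le p M)
    have h1 := (di_lemB (pClosureOf p L) (bot_le : ⊥ ≤ pClosureOf p M) (di_pos_of_fin _ _)).1
    rw [sup_bot_eq] at h1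
    rw [di_LD_iff _ _ h1, ← sup_assoc, sup_eq_left.2 hA]
  have hpc : pClosure k K p = pClosureOf p ⊤ := by
    simp [pClosure, pClosureOf]
  have hfd02 : FiniteDimensional k ↥(M₀ ⊔ M₂) := inferInstance
  have h0 := hcore (M₀ ⊔ M₂) le_rfl hfd02
  rw [hα, hβ, hγ]
  refine ⟨by exact_mod_cast h0.1, ?_⟩
  have hcast : ((α : Cardinal) = γ + β) ↔ α = γ + β := by norm_cast
  rw [hcast]
  constructor
  · intro heq
    let J := {M : IntermediateField k K // FiniteDimensional k M ∧ M₀ ⊔ M₂ ≤ M}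
    have : Nonempty J := ⟨⟨M₀ ⊔ M₂, hfd02, le_rfl⟩⟩
    have : IsDirectedOrder J := ⟨fun x y => by
      have := x.2.1
      have := y.2.1
      exact ⟨⟨x.1 ⊔ y.1, inferInstance, x.2.2.trans le_sup_left⟩,
        (le_sup_left : x.1 ≤ _), (le_sup_right : y.1 ≤ _)⟩⟩
    have hsup : (⨆ i : J, i.1) = ⊤ := by
      rw [eq_top_iff]
      intro x hx
      have hfx : FiniteDimensional k k⟮x⟯ :=
        adjoin.finiteDimensional (Algebra.IsIntegral.isIntegral x)
      let i : J := ⟨(M₀ ⊔ M₂) ⊔ k⟮x⟯, inferInstance, le_sup_left⟩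
      exact (le_iSup (fun i : J => i.1) i) ((le_sup_right : k⟮x⟯ ≤ (M₀ ⊔ M₂) ⊔ k⟮x⟯)
        (mem_adjoin_simple_self k x))
    refine di_LD_iSup hA hB (fun i : J => pClosureOf p L ⊔ pClosureOf p i.1) ?_
      (fun i => le_sup_left) ?_ ?_
    · intro i j h
      exact sup_le_sup_left ((di_pC_gc p).monotone_l h) _
    · rw [hpc, ← sup_iSup, ← (di_pC_gc p).l_iSup, hsup]
      exact (sup_eq_right.2 ((di_pC_gc p).monotone_l le_top)).symm
    · intro i
      exact (hcond i.1 i.2.1).2 ((hcore i.1 i.2.2 i.2.1).2.1 heq)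
  · intro H
    refine h0.2.2 ((hcond _ hfd02).1 (H.of_le_right ?_))
    have : pClosureOf p L ⊔ pClosureOf p (M₀ ⊔ M₂) ≤ pClosure k K p :=
      sup_le hB (hpc ▸ (di_pC_gc p).monotone_l le_top)
    exact this

end Final
set_option synthInstance.maxHeartbeats 1000000 in
/-- For `q`-finite purely inseparable extensions `k ⊆ L ⊆ K`,
`di(K/k) ≤ di(K/L) + di(L/k)`, with equality iff `L` and `k(K^p)` are linearly
disjoint over `k(L^p)`. -/
theorem di_le_add_and_eq_iff_linearDisjoint
    (p : ℕ) [Fact p.Prime] (k K : Type*) [Field k] [Field K] [Algebra k K] [CharP k p]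
    [IsPurelyInseparable k K]
    (L : IntermediateField k K)
    (hqK : di k K p < Cardinal.aleph0)
    (hqL : di k ↥L p < Cardinal.aleph0)
    (hqKL : di ↥L K p < Cardinal.aleph0) :
    di k K p ≤ di ↥L K p + di k ↥L p ∧
      (di k K p = di ↥L K p + di k ↥L p ↔
        (IntermediateField.extendScalars
            (show pClosureOf p L ≤ L from
              IntermediateField.adjoin_le_iff.mpr (by
                rintro x ⟨y, hy, rfl⟩; exact pow_mem hy p))).LinearDisjoint
          ↥(IntermediateField.extendScalars
            (show pClosureOf p L ≤ pClosure k K p from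
              IntermediateField.adjoin_le_iff.mpr (by
                rintro x ⟨y, hy, rfl⟩
                exact IntermediateField.subset_adjoin k
                  {x : K | ∃ y : K, y ^ p = x} ⟨y, rfl⟩)))) := by
  have : CharP K p := charP_of_injective_algebraMap (algebraMap k K).injective p
  have : ExpChar k p := ExpChar.prime Fact.out
  refine di_final p ?_ L hqK hqL hqKL _ _
  intro x
  obtain ⟨n, y, hy⟩ := IsPurelyInseparable.pow_mem k p x
  exact ⟨n, IntermediateField.mem_bot.2 ⟨y, hy⟩⟩
end

section
/- Let K/k be a q-finite purely inseparable extension of characteristic p > 0 and L/k a relatively perfect subextension (k(L^p) = L). Then di(K/k) = di(K/L) + di(L/k). -/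
/-!
Common definitions: purely inseparable extension theory (r-bases, degree of
irrationality, relative perfect closure, modularity), following Fliouet,
"Extensions absolument lq-finies".
-/

open IntermediateField

section SubfieldTheory

variable {Ω : Type*} [Field Ω] {p : ℕ}

/-- finitely generated over `A` -/
def Fg (A E : Subfield Ω) : Prop := ∃ S : Finset Ω, E = A ⊔ Subfield.closure (S : Set Ω)

theorem Fg.le {A E : Subfield Ω} (h : Fg A E) : A ≤ E := by
  obtain ⟨S, rfl⟩ := h
  exact le_sup_left

theorem Fg.refl (A : Subfield Ω) : Fg A A := ⟨∅, by simp⟩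

theorem Fg.sup {A E F : Subfield Ω} (h : Fg A E) (h' : Fg A F) : Fg A (E ⊔ F) := by
  classical
  obtain ⟨S, rfl⟩ := h
  obtain ⟨T, rfl⟩ := h'
  refine ⟨S ∪ T, ?_⟩
  rw [Finset.coe_union, Subfield.closure_union, ← sup_sup_distrib_left]

theorem sup_sing_eq {M : Subfield Ω} {x : Ω} (h : x ∈ M) : M ⊔ Subfield.closure {x} = M :=
  sup_eq_left.2 (by simpa using h)

theorem Fg.singleton (A : Subfield Ω) (x : Ω) : Fg A (A ⊔ Subfield.closure {x}) :=
  ⟨{x}, by simp⟩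

theorem Fg.base {A E : Subfield Ω} (h : Fg A E) (B : Subfield Ω) (hA : A ≤ B) : Fg B (B ⊔ E) := by
  obtain ⟨S, rfl⟩ := h
  exact ⟨S, by rw [← sup_assoc, sup_eq_left.2 hA]⟩

theorem Fg.base' {A B E : Subfield Ω} (h : Fg A E) (hA : A ≤ B) (hE : B ≤ E) : Fg B E := by
  have := h.base B hA
  rwa [sup_eq_right.2 hE] at this

theorem Fg.map {Ω' : Type*} [Field Ω'] {A E : Subfield Ω} (h : Fg A E) (f : Ω →+* Ω') :
    Fg (A.map f) (E.map f) := by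
  classical
  obtain ⟨S, rfl⟩ := h
  refine ⟨S.image f, ?_⟩
  rw [Subfield.map_sup, RingHom.map_field_closure, Finset.coe_image]

theorem Fg.of_map {Ω' : Type*} [Field Ω'] {A E : Subfield Ω} (f : Ω →+* Ω')
    (h : Fg (A.map f) (E.map f)) : Fg A E := by
  classical
  obtain ⟨S, hS⟩ := h
  have hsub : (S : Set Ω') ⊆ Set.range f := by
    intro x hx
    have : x ∈ E.map f := by
      rw [hS]
      exact (le_sup_right : _ ≤ A.map f ⊔ _) (Subfield.subset_closure hx)
    obtain ⟨y, _, rfl⟩ := this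
    exact ⟨y, rfl⟩
  obtain ⟨T, -, hT⟩ := Finset.subset_set_image_iff.1 (by simpa using hsub : (S : Set Ω') ⊆ f '' Set.univ)
  refine ⟨T, ?_⟩
  have hinj : Function.Injective (Subfield.map f) := fun X Y h => by
    rw [← Subfield.comap_map f X, ← Subfield.comap_map f Y, h]
  apply hinj
  rw [hS, Subfield.map_sup, RingHom.map_field_closure, ← hT, Finset.coe_image]

/-- everything is radical over `A` -/
def Rad (p : ℕ) (A : Subfield Ω) : Prop := ∀ x : Ω, ∃ n : ℕ, x ^ p ^ n ∈ A

theorem Rad.mono {A B : Subfield Ω} (h : Rad p A) (hle : A ≤ B) : Rad p B := fun x =>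
  let ⟨n, hn⟩ := h x
  ⟨n, hle hn⟩

variable [Fact p.Prime] [CharP Ω p]

/-- The `p`-th powers of `E`. -/
def Fr (p : ℕ) [Fact p.Prime] [CharP Ω p] (E : Subfield Ω) : Subfield Ω := E.map (frobenius Ω p)

theorem Fr_mono {E F : Subfield Ω} (h : E ≤ F) : Fr p E ≤ Fr p F :=
  (Subfield.gc_map_comap _).monotone_l h

theorem Fr_sup (E F : Subfield Ω) : Fr p (E ⊔ F) = Fr p E ⊔ Fr p F := Subfield.map_sup _ _ _

theorem mem_Fr {E : Subfield Ω} {x : Ω} : x ∈ Fr p E ↔ ∃ y ∈ E, y ^ p = x := by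
  simp [Fr, Subfield.mem_map, frobenius_def]

theorem pow_mem_Fr {E : Subfield Ω} {x : Ω} (h : x ∈ E) : x ^ p ∈ Fr p E := mem_Fr.2 ⟨x, h, rfl⟩

theorem Fr_le (E : Subfield Ω) : Fr p E ≤ E := by
  intro x hx
  obtain ⟨y, hy, rfl⟩ := mem_Fr.1 hx
  exact pow_mem hy p

theorem Fr_singleton_le {M : Subfield Ω} {x : Ω} (h : x ^ p ∈ M) :
    Fr p (M ⊔ Subfield.closure {x}) ≤ M := by
  rw [Fr_sup]
  refine sup_le (Fr_le M) ?_
  rw [Fr, RingHom.map_field_closure, Subfield.closure_le]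
  simpa [frobenius_def] using h

theorem relfinrank_step {M : Subfield Ω} {x : Ω} (h : x ^ p ∈ M) (hx : x ∉ M) :
    Subfield.relfinrank M (M ⊔ Subfield.closure {x}) = p := by
  have hp : p.Prime := Fact.out
  have e : M ⊔ Subfield.closure {x} = (IntermediateField.adjoin M {x}).toSubfield := by
    rw [IntermediateField.adjoin_toSubfield, Subfield.closure_union]
    congr 1
    have : Set.range (algebraMap M Ω) = (M : Set Ω) := by
      ext y
      exact ⟨fun ⟨a, ha⟩ => ha ▸ a.2, fun hy => ⟨⟨y, hy⟩, rfl⟩⟩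
    rw [this, Subfield.closure_eq]
  have hm : minpoly M x = Polynomial.X ^ p - Polynomial.C (⟨x ^ p, h⟩ : M) := by
    symm
    apply minpoly.eq_of_irreducible_of_monic
    · apply X_pow_sub_C_irreducible_of_prime hp
      intro b hb
      apply hx
      have : (b : Ω) ^ p = x ^ p := by
        have := congrArg (fun t : M => (t : Ω)) hb
        simpa using this
      have := frobenius_inj Ω p (by simpa [frobenius_def] using this : frobenius Ω p b = frobenius Ω p x)
      rw [← this]; exact b.2
    · have : algebraMap M Ω ⟨x ^ p, h⟩ = x ^ p := rfl
      simp [this]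
    · exact Polynomial.monic_X_pow_sub_C _ hp.ne_zero
  have hxint : IsIntegral M x := by
    by_contra hn
    have := minpoly.eq_zero hn
    rw [hm] at this
    exact (Polynomial.monic_X_pow_sub_C (⟨x ^ p, h⟩ : M) hp.ne_zero).ne_zero this
  rw [Subfield.relfinrank_eq_finrank_of_le le_sup_left]
  have := IntermediateField.adjoin.finrank hxint
  rw [hm, Polynomial.natDegree_X_pow_sub_C] at this
  rw [← this]
  have e2 : Subfield.extendScalars (le_sup_left : M ≤ M ⊔ Subfield.closure {x})
      = IntermediateField.adjoin M {x} := by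
    apply IntermediateField.toSubfield_injective
    rw [← e]; rfl
  rw [e2]

theorem step_exchange {M : Subfield Ω} {x y : Ω} (h : x ^ p ∈ M)
    (hy : y ∈ M ⊔ Subfield.closure {x}) (hyM : y ∉ M) : x ∈ M ⊔ Subfield.closure {y} := by
  have hp : p.Prime := Fact.out
  have hx : x ∉ M := by
    intro hx
    apply hyM
    have : M ⊔ Subfield.closure {x} ≤ M := sup_le le_rfl (by simpa using hx)
    exact this hy
  have hyp : y ^ p ∈ M := Fr_singleton_le h (pow_mem_Fr hy)
  have hle : M ⊔ Subfield.closure {y} ≤ M ⊔ Subfield.closure {x} :=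
    sup_le le_sup_left (by simpa using hy)
  have := Subfield.relfinrank_mul_relfinrank (le_sup_left : M ≤ M ⊔ Subfield.closure {y}) hle
  rw [relfinrank_step h hx, relfinrank_step hyp hyM] at this
  have h1 := Nat.eq_of_mul_eq_mul_left hp.pos (this.trans (mul_one p).symm)
  exact Subfield.relfinrank_eq_one_iff.1 h1
    ((le_sup_right : _ ≤ M ⊔ _) (Subfield.subset_closure (Set.mem_singleton _)))

theorem fg_induction {A : Subfield Ω} (hA : Rad p A) (P : Subfield Ω → Prop) (h0 : P A)
    (hs : ∀ F x, Fg A F → P F → x ^ p ∈ F → x ∉ F → P (F ⊔ Subfield.closure {x})) :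
    ∀ F, Fg A F → P F := by
  classical
  have key : ∀ n F x, Fg A F → P F → x ^ p ^ n ∈ F → P (F ⊔ Subfield.closure {x}) := by
    intro n
    induction n with
    | zero =>
      intro F x hF hP hx
      have : F ⊔ Subfield.closure {x} = F := sup_sing_eq (by simpa using hx)
      rwa [this]
    | succ n ih =>
      intro F x hF hP hx
      have h1 := ih F (x ^ p) hF hP (by rwa [← pow_mul, ← pow_succ'])
      have h2 : Fg A (F ⊔ Subfield.closure {x ^ p}) := by
        have := hF.sup (Fg.singleton A (x ^ p))
        rwa [← sup_assoc, sup_eq_left.2 hF.le] at this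
      have e : F ⊔ Subfield.closure {x ^ p} ⊔ Subfield.closure {x} = F ⊔ Subfield.closure {x} := by
        rw [sup_assoc]
        congr 1
        apply sup_eq_right.2
        rw [Subfield.closure_le]
        simp only [Set.singleton_subset_iff, SetLike.mem_coe]
        exact pow_mem (Subfield.subset_closure (Set.mem_singleton x)) p
      have hxp : x ^ p ∈ F ⊔ Subfield.closure {x ^ p} :=
        (le_sup_right : _ ≤ F ⊔ _) (Subfield.subset_closure (Set.mem_singleton _))
      by_cases hxm : x ∈ F ⊔ Subfield.closure {x ^ p}
      · rw [← e, sup_sing_eq hxm]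
        exact h1
      · rw [← e]
        exact hs _ x h2 h1 hxp hxm
  rintro F ⟨S, rfl⟩
  induction S using Finset.induction_on with
  | empty => simpa using h0
  | insert x S _ ih =>
    obtain ⟨n, hn⟩ := hA x
    have := key n (A ⊔ Subfield.closure S) x ⟨S, rfl⟩ ih ((le_sup_left : A ≤ _) hn)
    rwa [sup_assoc, ← Subfield.closure_union, Set.union_singleton, ← Finset.coe_insert] at this

theorem relfinrank_pow {A : Subfield Ω} (hA : Rad p A) {F : Subfield Ω} (hF : Fg A F) :
    ∃ j, Subfield.relfinrank A F = p ^ j := by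
  revert F
  apply fg_induction hA (fun F => ∃ j, Subfield.relfinrank A F = p ^ j)
  · exact ⟨0, by simp⟩
  · rintro F x hF ⟨j, hj⟩ hx hxF
    refine ⟨j + 1, ?_⟩
    rw [← Subfield.relfinrank_mul_relfinrank hF.le le_sup_left, relfinrank_step hx hxF, hj, pow_succ]

theorem relfinrank_pos {A : Subfield Ω} (hA : Rad p A) {F : Subfield Ω} (hF : Fg A F) :
    0 < Subfield.relfinrank A F := by
  obtain ⟨j, hj⟩ := relfinrank_pow hA hF
  rw [hj]
  exact pow_pos (Fact.out : p.Prime).pos _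

/-- degrees do not grow under composition with `C` -/
theorem relfinrank_sup_le {A : Subfield Ω} (hA : Rad p A) (C : Subfield Ω) {F : Subfield Ω}
    (hF : Fg A F) :
    Subfield.relfinrank (A ⊔ C) (F ⊔ C) ≤ Subfield.relfinrank A F := by
  revert F
  apply fg_induction hA (fun F => Subfield.relfinrank (A ⊔ C) (F ⊔ C) ≤ Subfield.relfinrank A F)
  · simp
  · intro F x hF ih hx hxF
    have e : F ⊔ Subfield.closure {x} ⊔ C = (F ⊔ C) ⊔ Subfield.closure {x} := sup_right_comm _ _ _
    rw [e, ← Subfield.relfinrank_mul_relfinrank hF.le le_sup_left, relfinrank_step hx hxF,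
      ← Subfield.relfinrank_mul_relfinrank (sup_le_sup_right hF.le C) le_sup_left]
    refine Nat.mul_le_mul ih ?_
    by_cases h : x ∈ F ⊔ C
    · rw [sup_sing_eq h, Subfield.relfinrank_self]
      exact (Fact.out : p.Prime).pos
    · rw [relfinrank_step ((le_sup_left : F ≤ _) hx) h]

/-- `[E : A(E^p)]` -/
noncomputable def dl (p : ℕ) [Fact p.Prime] [CharP Ω p] (A E : Subfield Ω) : ℕ :=
  Subfield.relfinrank (A ⊔ Fr p E) E

theorem sup_Fr_le {A E : Subfield Ω} (h : A ≤ E) : A ⊔ Fr p E ≤ E := sup_le h (Fr_le E)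

theorem Rad.Fr {A : Subfield Ω} (hA : Rad p A) : Rad p (Fr p A) := by
  intro x
  obtain ⟨n, hn⟩ := hA x
  exact ⟨n + 1, mem_Fr.2 ⟨_, hn, by rw [← pow_mul, ← pow_succ]⟩⟩

theorem dl_mono {A E F : Subfield Ω} (hA : Rad p A) (hE : Fg A E) (hF : Fg A F) (h : E ≤ F) :
    dl p A E ≤ dl p A F := by
  have hEF : Fg E F := hF.base' hE.le h
  have hRE := hA.mono hE.le
  have h1 := Subfield.relfinrank_mul_relfinrank (sup_Fr_le (p := p) hE.le) h
  have h2 := Subfield.relfinrank_mul_relfinrank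
    (sup_le_sup_left (Fr_mono (p := p) h) A) (sup_Fr_le (p := p) hF.le)
  have h3 : Subfield.relfinrank (A ⊔ Fr p E) (A ⊔ Fr p F) ≤ Subfield.relfinrank E F := by
    have : Subfield.relfinrank (Fr p E) (Fr p F) = Subfield.relfinrank E F :=
      Subfield.relfinrank_map_map _ _ _
    rw [← this, sup_comm A, sup_comm A]
    exact relfinrank_sup_le hRE.Fr A (hEF.map _)
  have hpos := relfinrank_pos hRE hEF
  have h4 : dl p A E * Subfield.relfinrank E F ≤ dl p A F * Subfield.relfinrank E F := by
    unfold dl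
    rw [h1, ← h2, mul_comm]
    exact Nat.mul_le_mul_left _ h3
  exact Nat.le_of_mul_le_mul_right h4 hpos

theorem Fg.sup_Fr {A E : Subfield Ω} (h : Fg A E) : Fg A (A ⊔ Fr p E) := by
  classical
  obtain ⟨S, rfl⟩ := h
  refine ⟨S.image (frobenius Ω p), ?_⟩
  rw [Fr_sup, ← sup_assoc, sup_eq_left.2 (Fr_le A), Fr, RingHom.map_field_closure, Finset.coe_image]

theorem dl_pow {A E : Subfield Ω} (hA : Rad p A) (hE : Fg A E) : ∃ j, dl p A E = p ^ j :=
  relfinrank_pow (hA.mono le_sup_left) (hE.base' le_sup_left (sup_Fr_le hE.le))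

theorem exists_fg_mem_sup {k L F : Subfield Ω} (hk : k ≤ L) {x : Ω} (hx : x ∈ L ⊔ F) :
    ∃ E, Fg k E ∧ E ≤ L ∧ x ∈ E ⊔ F := by
  rw [← Subfield.closure_eq L, ← Subfield.closure_eq F, ← Subfield.closure_union] at hx
  induction hx using Subfield.closure_induction with
  | mem x hx =>
    rcases hx with hx | hx
    · exact ⟨_, Fg.singleton k x, sup_le hk (by simpa using hx),
        (le_sup_left : _ ≤ _ ⊔ F) ((le_sup_right : _ ≤ k ⊔ _) (Subfield.subset_closure (Set.mem_singleton _)))⟩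
    · exact ⟨k, Fg.refl k, hk, (le_sup_right : F ≤ _) hx⟩
  | one => exact ⟨k, Fg.refl k, hk, one_mem _⟩
  | add x y _ _ ihx ihy =>
    obtain ⟨E, h1, h2, h3⟩ := ihx
    obtain ⟨E', h1', h2', h3'⟩ := ihy
    exact ⟨E ⊔ E', h1.sup h1', sup_le h2 h2', add_mem (sup_le_sup_right le_sup_left F h3)
      (sup_le_sup_right le_sup_right F h3')⟩
  | mul x y _ _ ihx ihy =>
    obtain ⟨E, h1, h2, h3⟩ := ihx
    obtain ⟨E', h1', h2', h3'⟩ := ihy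
    exact ⟨E ⊔ E', h1.sup h1', sup_le h2 h2', mul_mem (sup_le_sup_right le_sup_left F h3)
      (sup_le_sup_right le_sup_right F h3')⟩
  | neg x _ ih =>
    obtain ⟨E, h1, h2, h3⟩ := ih
    exact ⟨E, h1, h2, neg_mem h3⟩
  | inv x _ ih =>
    obtain ⟨E, h1, h2, h3⟩ := ih
    exact ⟨E, h1, h2, inv_mem h3⟩

theorem exists_fg_stable {k L : Subfield Ω} (hA : Rad p k) (hk : k ≤ L) :
    ∀ F, Fg k F → ∃ E1, Fg k E1 ∧ E1 ≤ L ∧ ∀ E, E1 ≤ E → E ≤ L →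
      Subfield.relfinrank E (E ⊔ F) = Subfield.relfinrank L (L ⊔ F) := by
  apply fg_induction hA
  · refine ⟨k, Fg.refl k, hk, fun E h1 h2 => ?_⟩
    rw [sup_eq_left.2 h1, sup_eq_left.2 hk, Subfield.relfinrank_self, Subfield.relfinrank_self]
  · rintro F x hF ⟨E1, h1, h2, h3⟩ hx hxF
    have hmul : ∀ E : Subfield Ω, Subfield.relfinrank E (E ⊔ (F ⊔ Subfield.closure {x})) =
        Subfield.relfinrank E (E ⊔ F) *
          Subfield.relfinrank (E ⊔ F) (E ⊔ F ⊔ Subfield.closure {x}) := by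
      intro E
      rw [← sup_assoc, Subfield.relfinrank_mul_relfinrank le_sup_left le_sup_left]
    by_cases h : x ∈ L ⊔ F
    · obtain ⟨E2, g1, g2, g3⟩ := exists_fg_mem_sup hk h
      refine ⟨E1 ⊔ E2, h1.sup g1, sup_le h2 g2, fun E i1 i2 => ?_⟩
      have : x ∈ E ⊔ F := sup_le_sup_right (le_sup_right.trans i1) F g3
      rw [hmul, hmul, h3 E (le_sup_left.trans i1) i2,
        sup_sing_eq this,
        sup_sing_eq h,
        Subfield.relfinrank_self, Subfield.relfinrank_self]
    · refine ⟨E1, h1, h2, fun E i1 i2 => ?_⟩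
      have h' : x ∉ E ⊔ F := fun h' => h (sup_le_sup_right i2 F h')
      rw [hmul, hmul, h3 E i1 i2, relfinrank_step ((le_sup_right : F ≤ _) hx) h,
        relfinrank_step ((le_sup_right : F ≤ _) hx) h']

theorem exists_fg_le_Fr {k L : Subfield Ω} (hk : k ≤ L) (hL : k ⊔ Fr p L = L) {E : Subfield Ω}
    (hE : Fg k E) (hEL : E ≤ L) : ∃ E', Fg k E' ∧ E' ≤ L ∧ E ≤ k ⊔ Fr p E' := by
  classical
  obtain ⟨S, rfl⟩ := hE
  have hx : ∀ x ∈ L, ∃ E', Fg k E' ∧ E' ≤ L ∧ x ∈ k ⊔ Fr p E' := by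
    intro x hx
    rw [← hL, sup_comm] at hx
    obtain ⟨E, ⟨T, rfl⟩, h2, h3⟩ := exists_fg_mem_sup (k := Fr p k) (L := Fr p L) (F := k)
      (Fr_mono hk) hx
    rw [sup_comm, ← sup_assoc, sup_eq_left.2 (Fr_le k)] at h3
    have hT : (T : Set Ω) ⊆ frobenius Ω p '' (L : Set Ω) := by
      intro t ht
      have := h2 ((le_sup_right : _ ≤ Fr p k ⊔ _) (Subfield.subset_closure ht))
      obtain ⟨y, hy, hyt⟩ := mem_Fr.1 this
      exact ⟨y, hy, by simpa [frobenius_def] using hyt⟩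
    obtain ⟨U, hU, hUT⟩ := Finset.subset_set_image_iff.1 hT
    refine ⟨k ⊔ Subfield.closure U, ⟨U, rfl⟩, sup_le hk (Subfield.closure_le.2 hU), ?_⟩
    rw [← hUT, Finset.coe_image, ← RingHom.map_field_closure] at h3
    refine sup_le_sup_left ?_ k h3
    exact Fr_mono le_sup_right
  have hSL : ∀ x ∈ S, x ∈ L := fun x hx =>
    hEL ((le_sup_right : _ ≤ k ⊔ _) (Subfield.subset_closure hx))
  clear hEL
  induction S using Finset.induction_on with
  | empty => exact ⟨k, Fg.refl k, hk, by simp⟩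
  | insert x S _ ih =>
    obtain ⟨E, h1, h2, h3⟩ := ih (fun y hy => hSL y (Finset.mem_insert_of_mem hy))
    obtain ⟨E', h1', h2', h3'⟩ := hx x (hSL x (Finset.mem_insert_self x S))
    refine ⟨E ⊔ E', h1.sup h1', sup_le h2 h2', ?_⟩
    rw [Finset.coe_insert, Set.insert_eq, Subfield.closure_union]
    refine sup_le le_sup_left (sup_le ?_ ?_)
    · rw [Subfield.closure_le]
      simp only [Set.singleton_subset_iff, SetLike.mem_coe]
      exact sup_le_sup_left (Fr_mono le_sup_right) k h3'
    · exact (le_sup_right.trans h3).trans (sup_le_sup_left (Fr_mono le_sup_left) k)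

/-- the key additivity at a finite stage -/
theorem key_stage {k L : Subfield Ω} (hA : Rad p k) (hk : k ≤ L) (hL : k ⊔ Fr p L = L)
    {F E0 : Subfield Ω} (hF : Fg k F) (hE0 : Fg k E0) (hE0L : E0 ≤ L) :
    ∃ E, Fg k E ∧ E ≤ L ∧ E0 ≤ E ∧
      dl p k (E ⊔ F) = dl p L (L ⊔ F) * dl p k E := by
  obtain ⟨E1, a1, a2, a3⟩ := exists_fg_stable hA hk F hF
  obtain ⟨D1, b1, b2, b3⟩ := exists_fg_stable hA hk (k ⊔ Fr p F) hF.sup_Fr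
  set E2 := E0 ⊔ E1 ⊔ D1 with hE2
  have hE2L : E2 ≤ L := sup_le (sup_le hE0L a2) b2
  have hE2fg : Fg k E2 := (hE0.sup a1).sup b1
  obtain ⟨E3, c1, c2, c3⟩ := exists_fg_le_Fr (p := p) hk hL hE2fg hE2L
  set E := E2 ⊔ E3
  set C := k ⊔ Fr p E with hC
  set Fp := k ⊔ Fr p F with hFp
  have hEfg : Fg k E := hE2fg.sup c1
  have hEL : E ≤ L := sup_le hE2L c2
  have hE2C : E2 ≤ C := c3.trans (sup_le_sup_left (Fr_mono le_sup_right) k)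
  have hCE : C ≤ E := sup_Fr_le hEfg.le
  have hFpF : Fp ≤ F := sup_Fr_le hF.le
  refine ⟨E, hEfg, hEL, (le_sup_left.trans le_sup_left).trans (le_sup_left : E2 ≤ E), ?_⟩
  have e1 : k ⊔ Fr p (E ⊔ F) = C ⊔ Fp := by
    rw [Fr_sup, hC, hFp, ← sup_sup_distrib_left]
  have e2 : L ⊔ Fr p (L ⊔ F) = L ⊔ Fp := by
    rw [Fr_sup, hFp, ← sup_assoc, ← sup_assoc, sup_eq_left.2 (Fr_le L), sup_eq_left.2 hk]
  have hE1E : E1 ≤ E := (le_sup_right.trans le_sup_left).trans (le_sup_left : E2 ≤ E)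
  have hD1C : D1 ≤ C := le_sup_right.trans hE2C
  have f1 := a3 E hE1E hEL
  have f2 := b3 E (hD1C.trans hCE) hEL
  have f3 := b3 C hD1C (hCE.trans hEL)
  have hpos : 0 < Subfield.relfinrank L (L ⊔ Fp) :=
    relfinrank_pos (hA.mono hk) (hF.sup_Fr.base L hk)
  -- towers
  have t1 := Subfield.relfinrank_mul_relfinrank (le_sup_left : E ≤ E ⊔ Fp)
    (sup_le_sup_left hFpF E)
  have t2 := Subfield.relfinrank_mul_relfinrank (le_sup_left : L ≤ L ⊔ Fp)
    (sup_le_sup_left hFpF L)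
  have t3 := Subfield.relfinrank_mul_relfinrank (le_sup_left : C ≤ C ⊔ Fp)
    (sup_le_sup_right hCE Fp)
  have t4 := Subfield.relfinrank_mul_relfinrank hCE (le_sup_left : E ≤ E ⊔ Fp)
  have t5 := Subfield.relfinrank_mul_relfinrank
    (sup_le_sup_right hCE Fp) (sup_le_sup_left hFpF E)
  unfold dl
  rw [e1, e2, ← t5, mul_comm, ← hC]
  congr 1
  · apply Nat.eq_of_mul_eq_mul_left hpos
    rw [t2, ← f1, ← t1, f2]
  · apply Nat.eq_of_mul_eq_mul_left hpos
    rw [← f3, t3, ← t4, f2, f3, mul_comm]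

/-- all finitely generated subextensions of `B / A` have `di` at most `N` -/
def DI (p : ℕ) [Fact p.Prime] [CharP Ω p] (A B : Subfield Ω) (N : ℕ) : Prop :=
  ∀ E, E ≤ B → Fg A E → dl p A E ≤ p ^ N

end SubfieldTheory

section RB

variable {Ω : Type*} [Field Ω] {p : ℕ}

/-- `r`-freeness in terms of subfields -/
def Free (M : Subfield Ω) (B : Set Ω) : Prop := ∀ x ∈ B, x ∉ M ⊔ Subfield.closure (B \ {x})

theorem Free.mono {M M' : Subfield Ω} {B B' : Set Ω} (h : Free M B) (hM : M' ≤ M) (hB : B' ⊆ B) :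
    Free M' B' := fun x hx hx' =>
  h x (hB hx) (sup_le_sup hM (Subfield.closure_mono (Set.sdiff_subset_sdiff_left hB)) hx')

variable [Fact p.Prime] [CharP Ω p]

theorem relfinrank_free {M : Subfield Ω} (S : Finset Ω) (hS : ∀ x ∈ S, x ^ p ∈ M)
    (hf : Free M (S : Set Ω)) :
    Subfield.relfinrank M (M ⊔ Subfield.closure (S : Set Ω)) = p ^ S.card := by
  classical
  induction S using Finset.induction_on with
  | empty => simp
  | insert x S hx ih =>
    have ih' := ih (fun y hy => hS y (Finset.mem_insert_of_mem hy))
      (hf.mono le_rfl (by simp))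
    have hxn := hf x (by simp)
    have e : ((insert x S : Finset Ω) : Set Ω) \ {x} = S := by
      ext y
      simp only [Finset.coe_insert, Set.mem_sdiff, Set.mem_insert_iff, Set.mem_singleton_iff,
        SetLike.mem_coe]
      constructor
      · rintro ⟨h | h, h'⟩
        · exact absurd h h'
        · exact h
      · intro h
        exact ⟨Or.inr h, fun h' => hx (h' ▸ h)⟩
    rw [e] at hxn
    have e2 : M ⊔ Subfield.closure ((insert x S : Finset Ω) : Set Ω) =
        M ⊔ Subfield.closure (S : Set Ω) ⊔ Subfield.closure {x} := by
      rw [sup_assoc, ← Subfield.closure_union, Set.union_singleton, ← Finset.coe_insert]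
    rw [e2, ← Subfield.relfinrank_mul_relfinrank le_sup_left le_sup_left, ih',
      relfinrank_step ((le_sup_left : M ≤ _) (hS x (by simp))) hxn, Finset.card_insert_of_notMem hx,
      pow_succ]

theorem exists_rbasis {M : Subfield Ω} (hM : ∀ x : Ω, x ^ p ∈ M) :
    ∃ B : Set Ω, Free M B ∧ M ⊔ Subfield.closure B = ⊤ := by
  obtain ⟨B, hB⟩ := zorn_subset {B : Set Ω | Free M B} (by
    intro c hc hch
    refine ⟨⋃₀ c, ?_, fun s hs => Set.subset_sUnion_of_mem hs⟩
    rintro x ⟨s', hs', hxs'⟩ hx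
    have : Nonempty c := ⟨⟨s', hs'⟩⟩
    have hdir : Directed (· ≤ ·) (fun s : c => M ⊔ Subfield.closure ((s : Set Ω) \ {x})) := by
      intro s t
      rcases hch.total s.2 t.2 with h | h
      · exact ⟨t, sup_le_sup_left (Subfield.closure_mono (Set.sdiff_subset_sdiff_left h)) M, le_rfl⟩
      · exact ⟨s, le_rfl, sup_le_sup_left (Subfield.closure_mono (Set.sdiff_subset_sdiff_left h)) M⟩
    have hle : M ⊔ Subfield.closure (⋃₀ c \ {x}) ≤
        ⨆ s : c, M ⊔ Subfield.closure ((s : Set Ω) \ {x}) := by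
      refine sup_le (le_sup_left.trans (le_iSup
        (fun s : c => M ⊔ Subfield.closure ((s : Set Ω) \ {x})) ⟨s', hs'⟩)) ?_
      rw [Subfield.closure_le]
      rintro y ⟨⟨t, ht, hyt⟩, hyx⟩
      exact (le_iSup (fun s : c => M ⊔ Subfield.closure ((s : Set Ω) \ {x})) ⟨t, ht⟩)
        ((le_sup_right : _ ≤ M ⊔ _) (Subfield.subset_closure ⟨hyt, hyx⟩))
    obtain ⟨⟨t, ht⟩, hxt⟩ := (Subfield.mem_iSup_of_directed hdir).1 (hle hx)
    rcases hch.total hs' ht with h | h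
    · exact hc ht x (h hxs') hxt
    · exact hc hs' x hxs'
        (sup_le_sup_left (Subfield.closure_mono (Set.sdiff_subset_sdiff_left h)) M hxt))
  refine ⟨B, hB.prop, ?_⟩
  rw [eq_top_iff]
  rintro x -
  by_contra hx
  have hxB : x ∉ B := fun h => hx ((le_sup_right : _ ≤ M ⊔ _) (Subfield.subset_closure h))
  have hfree : Free M (insert x B) := by
    intro y hy hyc
    rcases hy with rfl | hy
    · apply hx
      rw [Set.insert_sdiff_self_of_notMem hxB] at hyc
      exact hyc
    · have hxy : x ≠ y := fun h => hxB (h ▸ hy)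
      rw [Set.insert_sdiff_of_notMem _ (by simpa using hxy), ← Set.union_singleton,
        Subfield.closure_union, ← sup_assoc] at hyc
      have := step_exchange (p := p) ((le_sup_left : M ≤ _) (hM x)) hyc (hB.prop y hy)
      apply hx
      rwa [sup_assoc, ← Subfield.closure_union, Set.union_singleton, Set.insert_sdiff_singleton,
        Set.insert_eq_of_mem hy] at this
  exact hxB (hB.le_of_ge hfree (Set.subset_insert x B) (Set.mem_insert x B))

theorem DI_iff_rbasis {A : Subfield Ω} {n : ℕ} (hA : ∀ x : Ω, x ^ p ^ n ∈ A) {B : Set Ω}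
    (hB : Free (A ⊔ Fr p ⊤) B) (hgen : A ⊔ Fr p ⊤ ⊔ Subfield.closure B = ⊤) (N : ℕ) :
    DI p A ⊤ N ↔ Cardinal.mk B ≤ N := by
  have hp : p.Prime := Fact.out
  have hpow : ∀ x : Ω, x ^ p ∈ A ⊔ Fr p ⊤ := fun x =>
    (le_sup_right : _ ≤ A ⊔ _) (pow_mem_Fr (Subfield.mem_top x))
  constructor
  · intro h
    rw [Cardinal.mk_le_iff_forall_finset_subset_card_le]
    intro S hS
    have h1 := h (A ⊔ Subfield.closure (S : Set Ω)) le_top ⟨S, rfl⟩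
    set E := A ⊔ Subfield.closure (S : Set Ω) with hE
    have h2 := relfinrank_free (p := p) (M := A ⊔ Fr p E) S
      (fun x hx => (le_sup_right : _ ≤ A ⊔ _)
        (pow_mem_Fr ((le_sup_right : _ ≤ A ⊔ _) (Subfield.subset_closure hx))))
      (hB.mono (sup_le_sup_left (Fr_mono le_top) A) hS)
    rw [sup_right_comm, ← hE, sup_eq_left.2 (Fr_le E)] at h2
    unfold dl at h1
    rw [h2] at h1
    exact (Nat.pow_le_pow_iff_right hp.one_lt).1 h1
  · intro h E _ hE
    have hfin : B.Finite := Cardinal.lt_aleph0_iff_set_finite.1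
      (h.trans_lt (Cardinal.natCast_lt_aleph0))
    obtain ⟨S, rfl⟩ := hfin.exists_finset_coe
    have hcard : S.card ≤ N := by simpa using h
    have hj : ∀ j : ℕ, (⊤ : Subfield Ω) =
        A ⊔ Subfield.closure (S : Set Ω) ⊔ (⊤ : Subfield Ω).map (iterateFrobenius Ω p j) := by
      intro j
      induction j with
      | zero =>
        have : (⊤ : Subfield Ω).map (iterateFrobenius Ω p 0) = ⊤ := by
          ext x; simp [Subfield.mem_map]
        rw [this, sup_top_eq]
      | succ j ih =>
        have e : (⊤ : Subfield Ω).map (iterateFrobenius Ω p (j + 1)) =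
            Fr p ((⊤ : Subfield Ω).map (iterateFrobenius Ω p j)) := by
          ext x
          simp [Fr, Subfield.mem_map, iterateFrobenius_def, frobenius_def, ← pow_mul, pow_succ]
        have h3 : Fr p ⊤ = Fr p (A ⊔ Subfield.closure (S : Set Ω)) ⊔
          Fr p ((⊤ : Subfield Ω).map (iterateFrobenius Ω p j)) := by
          rw [← Fr_sup, ← ih]
        rw [e, eq_comm, eq_top_iff]
        refine hgen.symm.le.trans ?_
        rw [sup_right_comm A]
        refine sup_le le_sup_left ?_
        rw [h3]
        generalize Fr p ((⊤ : Subfield Ω).map (iterateFrobenius Ω p j)) = W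
        exact sup_le ((Fr_le (A ⊔ Subfield.closure (S : Set Ω))).trans le_sup_left) le_sup_right
    have htop : (⊤ : Subfield Ω) = A ⊔ Subfield.closure (S : Set Ω) := by
      refine (hj n).trans (sup_eq_left.2 ?_)
      refine le_trans ?_ (le_sup_left : A ≤ _)
      rintro _ ⟨y, -, rfl⟩
      simpa [iterateFrobenius_def] using hA y
    have h1 := dl_mono (p := p) (fun x => ⟨n, hA x⟩) hE ⟨S, htop⟩ le_top
    refine h1.trans ?_
    unfold dl
    have h2 := relfinrank_free (p := p) (M := A ⊔ Fr p ⊤) S (fun x _ => hpow x) hB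
    rw [hgen] at h2
    rw [h2]
    exact Nat.pow_le_pow_right hp.pos hcard

theorem DI_map {Ω' : Type*} [Field Ω'] [CharP Ω' p] (f : Ω →+* Ω') (A B : Subfield Ω) (N : ℕ) :
    DI p (A.map f) (B.map f) N ↔ DI p A B N := by
  have hFr : ∀ E : Subfield Ω, Fr p (E.map f) = (Fr p E).map f := by
    intro E
    ext x
    simp [Fr, Subfield.mem_map, frobenius_def]
  have hdl : ∀ E : Subfield Ω, dl p (A.map f) (E.map f) = dl p A E := by
    intro E
    unfold dl
    rw [hFr, ← Subfield.map_sup, Subfield.relfinrank_map_map]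
  constructor
  · intro h E hE hfg
    rw [← hdl]
    exact h _ ((Subfield.gc_map_comap f).monotone_l hE) (hfg.map f)
  · intro h E hE hfg
    have : (E.comap f).map f = E := by
      apply Subfield.map_comap_eq_self
      intro x hx
      obtain ⟨y, -, rfl⟩ := hE hx
      exact ⟨y, rfl⟩
    rw [← this] at hfg hE ⊢
    rw [hdl]
    refine h _ ?_ (hfg.of_map f)
    rw [← Subfield.comap_map f B]
    exact (Subfield.map_le_iff_le_comap).1 hE

end RB

section Types

variable (k K : Type*) [Field k] [Field K] [Algebra k K] (p : ℕ) [Fact p.Prime] [CharP K p]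

theorem adjoin_pClosure_toSubfield (S : Set K) :
    (adjoin (pClosure k K p) S).toSubfield =
      (algebraMap k K).fieldRange ⊔ Fr p ⊤ ⊔ Subfield.closure S := by
  have h1 : (pClosure k K p).toSubfield = (algebraMap k K).fieldRange ⊔ Fr p ⊤ := by
    rw [pClosure, IntermediateField.adjoin_toSubfield, Subfield.closure_union]
    congr 1
    · rw [← RingHom.coe_fieldRange, Subfield.closure_eq]
    · have : {x : K | ∃ y : K, y ^ p = x} = (Fr p (⊤ : Subfield K) : Set K) := by
        ext x
        simp [mem_Fr]
      rw [this, Subfield.closure_eq]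
  rw [IntermediateField.adjoin_toSubfield, Subfield.closure_union, ← h1]
  congr 1
  have : Set.range (algebraMap (pClosure k K p) K) = ((pClosure k K p).toSubfield : Set K) := by
    ext y
    exact ⟨fun ⟨a, ha⟩ => ha ▸ a.2, fun hy => ⟨⟨y, hy⟩, rfl⟩⟩
  rw [this, Subfield.closure_eq]

theorem RBasis_iff (B : Set K) : RBasis k K p B ↔
    Free ((algebraMap k K).fieldRange ⊔ Fr p ⊤) B ∧
      (algebraMap k K).fieldRange ⊔ Fr p ⊤ ⊔ Subfield.closure B = ⊤ := by
  unfold RBasis RFreeOver Free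
  rw [and_comm]
  simp_rw [← adjoin_pClosure_toSubfield]
  refine and_congr Iff.rfl ?_
  rw [← IntermediateField.toSubfield_inj, IntermediateField.top_toSubfield]

theorem diCard_le_iff {n : ℕ} (hA : ∀ x : K, x ^ p ^ n ∈ (algebraMap k K).fieldRange) (N : ℕ) :
    diCard k K p ≤ N ↔ DI p (algebraMap k K).fieldRange ⊤ N := by
  have hne : {c : Cardinal | ∃ B : Set K, RBasis k K p B ∧ Cardinal.mk B = c}.Nonempty := by
    obtain ⟨B, h1, h2⟩ := exists_rbasis (p := p) (M := (algebraMap k K).fieldRange ⊔ Fr p ⊤)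
      (fun x => (le_sup_right : _ ≤ (algebraMap k K).fieldRange ⊔ _)
        (pow_mem_Fr (Subfield.mem_top x)))
    exact ⟨_, B, (RBasis_iff k K p B).2 ⟨h1, h2⟩, rfl⟩
  obtain ⟨B, hB, hc⟩ := csInf_mem hne
  rw [RBasis_iff] at hB
  rw [DI_iff_rbasis hA hB.1 hB.2, hc]
  rfl

/-- elements of exponent at most `n` -/
def Kn (A : Subfield K) (n : ℕ) : Subfield K := A.comap (iterateFrobenius K p n)

theorem mem_Kn {A : Subfield K} {n : ℕ} {x : K} : x ∈ Kn K p A n ↔ x ^ p ^ n ∈ A := by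
  simp [Kn, iterateFrobenius_def]

theorem expleq_toSubfield (n : ℕ) :
    (expleq k K p n).toSubfield = Kn K p (algebraMap k K).fieldRange n := by
  rw [expleq, IntermediateField.adjoin_toSubfield]
  have : Set.range (algebraMap k K) ∪ {x : K | x ^ p ^ n ∈ (algebraMap k K).range} =
      (Kn K p (algebraMap k K).fieldRange n : Set K) := by
    ext x
    rw [SetLike.mem_coe, mem_Kn]
    constructor
    · rintro (⟨y, rfl⟩ | h)
      · exact pow_mem (RingHom.mem_fieldRange.2 ⟨y, rfl⟩) _
      · exact h
    · intro h
      exact Or.inr h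
  rw [this, Subfield.closure_eq]

theorem diCard_expleq_le_iff (n N : ℕ) :
    diCard k (expleq k K p n) p ≤ N ↔
      DI p (algebraMap k K).fieldRange (Kn K p (algebraMap k K).fieldRange n) N := by
  have : CharP (expleq k K p n) p :=
    (algebraMap (expleq k K p n) K).charP (algebraMap (expleq k K p n) K).injective p
  rw [diCard_le_iff k (expleq k K p n) p (n := n), ← DI_map (algebraMap (expleq k K p n) K)]
  · have e1 : (algebraMap k (expleq k K p n)).fieldRange.map (algebraMap (expleq k K p n) K) =
        (algebraMap k K).fieldRange := by
      rw [RingHom.map_fieldRange]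
      rfl
    have e2 : (⊤ : Subfield (expleq k K p n)).map (algebraMap (expleq k K p n) K) =
        Kn K p (algebraMap k K).fieldRange n := by
      rw [← RingHom.fieldRange_eq_map, ← expleq_toSubfield]
      ext x
      exact ⟨fun ⟨a, ha⟩ => ha ▸ a.2, fun hy => ⟨⟨x, hy⟩, rfl⟩⟩
    rw [e1, e2]
  · rintro ⟨x, hx⟩
    have hx' : x ∈ (expleq k K p n).toSubfield := hx
    rw [expleq_toSubfield, mem_Kn] at hx'
    obtain ⟨y, hy⟩ := hx'
    exact ⟨y, Subtype.ext hy⟩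

theorem di_le_iff (hA : Rad p (algebraMap k K).fieldRange) (N : ℕ) :
    di k K p ≤ N ↔ DI p (algebraMap k K).fieldRange ⊤ N := by
  classical
  unfold di
  rw [ciSup_le_iff' Cardinal.bddAbove_of_small]
  simp_rw [diCard_expleq_le_iff]
  constructor
  · intro h E _ hE
    suffices ∃ n, E ≤ Kn K p (algebraMap k K).fieldRange n by
      obtain ⟨n, hn⟩ := this
      exact h n E hn hE
    have hmono : ∀ n m, n ≤ m → Kn K p (algebraMap k K).fieldRange n ≤
        Kn K p (algebraMap k K).fieldRange m := by
      intro n m hnm x hx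
      rw [mem_Kn] at hx ⊢
      obtain ⟨j, rfl⟩ := Nat.exists_eq_add_of_le hnm
      rw [pow_add, pow_mul]
      exact pow_mem hx _
    obtain ⟨S, rfl⟩ := hE
    induction S using Finset.induction_on with
    | empty => exact ⟨0, by
        refine sup_le (fun x hx => ?_) (by simp)
        rw [mem_Kn]; simpa using hx⟩
    | insert x S _ ih =>
      obtain ⟨n, hn⟩ := ih le_top
      obtain ⟨m, hm⟩ := hA x
      refine ⟨max n m, ?_⟩
      rw [Finset.coe_insert, Set.insert_eq, Subfield.closure_union]
      have h1 := hn.trans (hmono n _ (le_max_left n m))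
      refine sup_le (le_sup_left.trans h1) (sup_le ?_ (le_sup_right.trans h1))
      rw [Subfield.closure_le, Set.singleton_subset_iff]
      exact hmono m _ (le_max_right n m) ((mem_Kn K p).2 hm)
  · intro h n E _ hE
    exact h E le_top hE

end Types

section Final

variable {Ω : Type*} [Field Ω] {p : ℕ} [Fact p.Prime] [CharP Ω p]

theorem exists_dl_eq {A B : Subfield Ω} (hA : Rad p A) (hAB : A ≤ B) {N : ℕ}
    (h : ∀ M : ℕ, DI p A B M ↔ N ≤ M) : ∃ E, E ≤ B ∧ Fg A E ∧ dl p A E = p ^ N := by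
  have hp : p.Prime := Fact.out
  have hN := (h N).2 le_rfl
  rcases Nat.eq_zero_or_pos N with rfl | hpos
  · refine ⟨A, hAB, Fg.refl A, ?_⟩
    unfold dl
    rw [sup_eq_left.2 (Fr_le A), Subfield.relfinrank_self, pow_zero]
  · have : ¬ DI p A B (N - 1) := fun h' => by
      have := (h (N - 1)).1 h'
      omega
    unfold DI at this
    push Not at this
    obtain ⟨E, h1, h2, h3⟩ := this
    refine ⟨E, h1, h2, ?_⟩
    obtain ⟨j, hj⟩ := dl_pow hA h2
    have h4 := hN E h1 h2
    rw [hj] at h3 h4 ⊢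
    rw [Nat.pow_le_pow_iff_right hp.one_lt] at h4
    rw [Nat.pow_lt_pow_iff_right hp.one_lt] at h3
    congr 1
    omega

theorem DI_top_of_rp {k L : Subfield Ω} (hA : Rad p k) (hk : k ≤ L) (hL : k ⊔ Fr p L = L)
    {m : ℕ} (h : DI p k ⊤ m) : DI p L ⊤ m := by
  rintro E - ⟨S, rfl⟩
  have hF : Fg k (k ⊔ Subfield.closure (S : Set Ω)) := ⟨S, rfl⟩
  obtain ⟨E, h1, h2, h3, h4⟩ := key_stage hA hk hL hF (Fg.refl k) hk
  rw [← sup_assoc L, sup_eq_left.2 hk] at h4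
  have h5 := h _ le_top (h1.sup hF)
  rw [h4] at h5
  refine le_trans ?_ h5
  obtain ⟨j, hj⟩ := dl_pow (p := p) hA h1
  rw [hj]
  exact Nat.le_mul_of_pos_right _ (pow_pos (Fact.out : p.Prime).pos _)

theorem di_add_subfield {k L : Subfield Ω} (hA : Rad p k) (hk : k ≤ L) (hL : k ⊔ Fr p L = L)
    {m a b : ℕ} (hm : ∀ M : ℕ, DI p k ⊤ M ↔ m ≤ M) (ha : ∀ M : ℕ, DI p L ⊤ M ↔ a ≤ M)
    (hb : ∀ M : ℕ, DI p k L M ↔ b ≤ M) : m = a + b := by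
  have hp : p.Prime := Fact.out
  apply le_antisymm
  · obtain ⟨F, -, hF, hd⟩ := exists_dl_eq hA le_top hm
    obtain ⟨E, h1, h2, h3, h4⟩ := key_stage hA hk hL hF (Fg.refl k) hk
    have h5 := dl_mono hA hF (h1.sup hF) le_sup_right
    rw [hd, h4] at h5
    have h6 := h5.trans (Nat.mul_le_mul ((ha a).2 le_rfl _ le_top (hF.base L hk))
      ((hb b).2 le_rfl E h2 h1))
    rw [← pow_add] at h6
    exact (Nat.pow_le_pow_iff_right hp.one_lt).1 h6
  · obtain ⟨_, -, ⟨S, rfl⟩, hd⟩ := exists_dl_eq (hA.mono hk) le_top ha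
    obtain ⟨E0, hE0L, hE0, hd0⟩ := exists_dl_eq hA hk hb
    have hF : Fg k (k ⊔ Subfield.closure (S : Set Ω)) := ⟨S, rfl⟩
    obtain ⟨E, h1, h2, h3, h4⟩ := key_stage hA hk hL hF hE0 hE0L
    rw [← sup_assoc L, sup_eq_left.2 hk, hd] at h4
    have h5 := (hm m).2 le_rfl _ le_top (h1.sup hF)
    have h6 := dl_mono hA hE0 h1 h3
    rw [hd0] at h6
    rw [h4] at h5
    have h7 := (Nat.mul_le_mul_left (p ^ a) h6).trans h5
    rw [← pow_add] at h7
    exact (Nat.pow_le_pow_iff_right hp.one_lt).1 h7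

end Final

/-- For a `q`-finite purely inseparable extension `K/k` and a
relatively perfect subextension `L/k`, `di(K/k) = di(K/L) + di(L/k)`. -/
theorem di_add_of_relativelyPerfect
    (p : ℕ) [Fact p.Prime] (k K : Type*) [Field k] [Field K] [Algebra k K] [CharP k p]
    [IsPurelyInseparable k K]
    (L : IntermediateField k K)
    (hq : di k K p < Cardinal.aleph0)
    (hRP : pClosureOf p L = L) :
    di k K p = di ↥L K p + di k ↥L p := by
  have : CharP K p := charP_of_injective_algebraMap' k (A := K) p
  have : CharP L p := charP_of_injective_algebraMap' k (A := L) p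
  have hA : Rad p (algebraMap k K).fieldRange := fun x => by
    obtain ⟨n, hn⟩ := IsPurelyInseparable.pow_mem k p x
    exact ⟨n, hn⟩
  have hLr : (algebraMap L K).fieldRange = L.toSubfield := by
    ext x
    exact ⟨fun ⟨a, ha⟩ => ha ▸ a.2, fun hy => ⟨⟨x, hy⟩, rfl⟩⟩
  have hk : (algebraMap k K).fieldRange ≤ L.toSubfield := by
    rintro _ ⟨y, rfl⟩
    exact L.algebraMap_mem y
  have hL : (algebraMap k K).fieldRange ⊔ Fr p L.toSubfield = L.toSubfield := by
    conv_rhs => rw [← hRP]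
    rw [pClosureOf, IntermediateField.adjoin_toSubfield, Subfield.closure_union]
    congr 1
    · rw [← RingHom.coe_fieldRange, Subfield.closure_eq]
    · have : {x : K | ∃ y ∈ L, y ^ p = x} = (Fr p L.toSubfield : Set K) := by
        ext x
        simp [mem_Fr]
      rw [this, Subfield.closure_eq]
  have hAL : Rad p (algebraMap k L).fieldRange := fun x => by
    obtain ⟨n, y, hn⟩ := hA x
    exact ⟨n, y, Subtype.ext hn⟩
  have i1 := di_le_iff k K p hA
  have i2 := di_le_iff L K p (hLr ▸ hA.mono hk)
  have i3 := di_le_iff k L p hAL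
  rw [hLr] at i2
  have i3' : ∀ N : ℕ, di k L p ≤ N ↔ DI p (algebraMap k K).fieldRange L.toSubfield N := by
    intro N
    rw [i3, ← DI_map (algebraMap L K), ← RingHom.fieldRange_eq_map, hLr, RingHom.map_fieldRange]
    rfl
  obtain ⟨m, hm⟩ := Cardinal.lt_aleph0.1 hq
  have hDm := (i1 m).1 hm.le
  obtain ⟨a, ha⟩ := Cardinal.lt_aleph0.1
    (((i2 m).2 (DI_top_of_rp hA hk hL hDm)).trans_lt Cardinal.natCast_lt_aleph0)
  obtain ⟨b, hb⟩ := Cardinal.lt_aleph0.1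
    (((i3' m).2 (fun E _ hE => hDm E le_top hE)).trans_lt Cardinal.natCast_lt_aleph0)
  rw [hm] at i1
  rw [ha] at i2
  rw [hb] at i3'
  rw [hm, ha, hb]
  have := di_add_subfield hA hk hL (m := m) (a := a) (b := b)
    (fun M => by rw [← i1, Nat.cast_le]) (fun M => by rw [← i2, Nat.cast_le])
    (fun M => by rw [← i3', Nat.cast_le])
  rw [this, Nat.cast_add]
end

section
/- A q-finite purely inseparable extension K/k of characteristic p > 0 is finite if and only if di(K/k) = di(K/k(K^p)). -/
/-!
Common definitions: purely inseparable extension theory (r-bases, degree of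
irrationality, relative perfect closure, modularity), following Fliouet,
"Extensions absolument lq-finies".
-/

open IntermediateField

set_option linter.style.haveILetI false

section aux
open Module Polynomial

theorem aux_finrank_simple {F K : Type*} [Field F] [Field K] [Algebra F K] {p : ℕ}
    (hp : p.Prime) [CharP F p] (x : K) (hx : x ^ p ∈ (algebraMap F K).range)
    (hx' : x ∉ (algebraMap F K).range) : finrank F (adjoin F {x}) = p := by
  haveI : Fact p.Prime := ⟨hp⟩
  haveI : CharP K p := charP_of_injective_algebraMap (algebraMap F K).injective p
  obtain ⟨a, ha⟩ := hx
  have hirr : Irreducible (X ^ p - C a : F[X]) := by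
    apply X_pow_sub_C_irreducible_of_prime hp
    intro b hb
    apply hx'
    refine ⟨b, ?_⟩
    apply frobenius_inj K p
    simp only [frobenius_def]
    rw [← map_pow, hb, ha]
  have hm : X ^ p - C a = minpoly F x :=
    minpoly.eq_of_irreducible_of_monic hirr (by simp [ha]) (monic_X_pow_sub_C a hp.ne_zero)
  have hint : IsIntegral F x := by
    refine ⟨X ^ p - C a, monic_X_pow_sub_C a hp.ne_zero, by simp [ha]⟩
  rw [IntermediateField.adjoin.finrank hint, ← hm, natDegree_X_pow_sub_C]

/-- generic r-free -/
def RFr (F : Type*) {K : Type*} [Field F] [Field K] [Algebra F K] (B : Set K) : Prop :=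
  ∀ x ∈ B, x ∉ adjoin F (B \ {x})

theorem RFr.mono {F K : Type*} [Field F] [Field K] [Algebra F K] {B C : Set K}
    (h : RFr F B) (hC : C ⊆ B) : RFr F C := by
  intro x hx hx'
  exact h x (hC hx) (adjoin.mono F _ _ (Set.sdiff_subset_sdiff_left hC) hx')

theorem aux_insert {F K : Type*} [Field F] [Field K] [Algebra F K] (S : Set K) (x : K) :
    (adjoin (adjoin F S) {x}).restrictScalars F = adjoin F (insert x S) := by
  rw [adjoin_adjoin_left, Set.union_comm, Set.insert_eq]

theorem aux_not_range {F K : Type*} [Field F] [Field K] [Algebra F K] 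
    (E : IntermediateField F K) (x : K) (h : x ∉ E) : x ∉ (algebraMap E K).range := by
  rintro ⟨y, rfl⟩
  exact h y.2

theorem aux_step {F K : Type*} [Field F] [Field K] [Algebra F K] {p : ℕ}
    (hp : p.Prime) [CharP F p] (S : Set K) (x : K) (hx : x ^ p ∈ (algebraMap F K).range)
    (hS : x ∉ adjoin F S) :
    finrank F (adjoin F (insert x S)) = finrank F (adjoin F S) * p := by
  rw [← aux_insert]
  have h1 : x ^ p ∈ (algebraMap (adjoin F S) K).range := by
    obtain ⟨a, ha⟩ := hx
    exact ⟨algebraMap F _ a, by rw [← ha]; rfl⟩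
  haveI : CharP (adjoin F S) p := charP_of_injective_algebraMap (algebraMap F _).injective p
  rw [← aux_finrank_simple hp x h1 (aux_not_range _ _ hS)]
  exact (finrank_mul_finrank F (adjoin F S) (adjoin (adjoin F S) {x})).symm

theorem aux_finrank {F K : Type*} [Field F] [Field K] [Algebra F K] {p : ℕ}
    (hp : p.Prime) [CharP F p] (h : ∀ x : K, x ^ p ∈ (algebraMap F K).range) (s : Finset K) :
    RFr F (s : Set K) → finrank F (adjoin F (s : Set K)) = p ^ s.card := by
  classical
  induction s using Finset.induction_on with
  | empty => intro _; simp
  | insert x s hx ih =>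
    intro hf
    rw [Finset.coe_insert] at hf ⊢
    rw [aux_step hp _ x (h x), ih (hf.mono (Set.subset_insert _ _)), Finset.card_insert_of_notMem hx,
      pow_succ]
    have := hf x (Set.mem_insert _ _)
    rwa [Set.insert_sdiff_of_mem _ (Set.mem_singleton x),
      Set.sdiff_singleton_eq_self (by simpa using hx)] at this

/-- exchange -/
theorem aux_exchange {F K : Type*} [Field F] [Field K] [Algebra F K] {p : ℕ}
    (hp : p.Prime) [CharP F p] (h : ∀ x : K, x ^ p ∈ (algebraMap F K).range) (S : Set K) (b x : K)
    (hb : b ∉ adjoin F S) (hbx : b ∈ adjoin F (insert x S)) : x ∈ adjoin F (insert b S) := by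
  by_cases hx : x ∈ adjoin F S
  · exact adjoin.mono F _ _ (Set.subset_insert _ _) hx
  have h1 : ∀ x : K, x ^ p ∈ (algebraMap (adjoin F S) K).range := by
    intro x
    obtain ⟨a, ha⟩ := h x
    exact ⟨algebraMap F _ a, by rw [← ha]; rfl⟩
  haveI : CharP (adjoin F S) p := charP_of_injective_algebraMap (algebraMap F _).injective p
  have e1 := aux_finrank_simple hp x (h1 x) (aux_not_range _ _ hx)
  have e2 := aux_finrank_simple hp b (h1 b) (aux_not_range _ _ hb)
  haveI : FiniteDimensional (adjoin F S) (adjoin (adjoin F S) {x}) :=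
    FiniteDimensional.of_finrank_pos (by rw [e1]; exact hp.pos)
  rw [← aux_insert] at hbx ⊢
  have hle : adjoin (adjoin F S) {b} ≤ adjoin (adjoin F S) {x} := by
    rw [adjoin_le_iff, Set.singleton_subset_iff]
    exact hbx
  have := IntermediateField.eq_of_le_of_finrank_eq hle (e2.trans e1.symm)
  change x ∈ adjoin (adjoin F S) {b}
  rw [this]
  exact mem_adjoin_simple_self _ x

theorem aux_exists {F K : Type*} [Field F] [Field K] [Algebra F K] {p : ℕ}
    (hp : p.Prime) [CharP F p] (h : ∀ x : K, x ^ p ∈ (algebraMap F K).range) :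
    ∃ B : Set K, adjoin F B = ⊤ ∧ RFr F B := by
  obtain ⟨B, hB⟩ := zorn_subset {B : Set K | RFr F B} (by
    intro c hc hchain
    refine ⟨⋃₀ c, ?_, fun s hs => Set.subset_sUnion_of_mem hs⟩
    intro x hx hx'
    obtain ⟨T, hT, hxT⟩ := exists_finset_of_mem_adjoin hx'
    obtain ⟨t0, ht0, hxt0⟩ := hx
    have hfin : ((insert x (T : Set K)) : Set K).Finite := T.finite_toSet.insert x
    have hsub : insert x (T : Set K) ⊆ ⋃₀ c :=
      Set.insert_subset ⟨t0, ht0, hxt0⟩ (hT.trans Set.sdiff_subset)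
    obtain ⟨t, ht, htT⟩ := DirectedOn.exists_mem_subset_of_finite_of_subset_sUnion
      ⟨t0, ht0⟩ hchain.directedOn hfin hsub
    refine hc ht x (htT (Set.mem_insert _ _)) (adjoin.mono F _ _ ?_ hxT)
    intro y hy
    exact ⟨htT (Set.mem_insert_of_mem _ hy), (hT hy).2⟩)
  refine ⟨B, ?_, hB.1⟩
  by_contra hne
  obtain ⟨x, hx⟩ : ∃ x, x ∉ adjoin F B := by
    by_contra hcon
    push Not at hcon
    exact hne (eq_top_iff.2 fun y _ => hcon y)
  have hxB : x ∉ B := fun hh => hx (subset_adjoin F B hh)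
  have : RFr F (insert x B) := by
    intro b hb hb'
    by_cases hbx : b = x
    · subst hbx
      rw [Set.insert_sdiff_of_mem _ (Set.mem_singleton b), Set.sdiff_singleton_eq_self hxB] at hb'
      exact hx hb'
    · have hbB : b ∈ B := hb.resolve_left hbx
      rw [Set.insert_sdiff_of_notMem _ (by simpa using Ne.symm hbx)] at hb'
      have := aux_exchange hp h _ b x (hB.1 b hbB) hb'
      rw [Set.insert_sdiff_singleton, Set.insert_eq_of_mem hbB] at this
      exact hx this
  exact hxB (hB.2 this (Set.subset_insert _ _) (Set.mem_insert _ _))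

/-- Subfield lemma -/
theorem aux_sub {K : Type*} [Field K] (N P Q M : Subfield K) (hPN : P ≤ N) (hPQ : P ≤ Q)
    (hM : N ⊔ Q = M) (hfin : P.relfinrank Q ≠ 0) : N.relfinrank M ≤ P.relfinrank Q := by
  subst hM
  letI : Algebra P N := (Subfield.inclusion hPN).toAlgebra
  haveI : IsScalarTower P N K := IsScalarTower.of_algebraMap_eq (fun _ => rfl)
  rw [Subfield.relfinrank_eq_finrank_of_le hPQ] at hfin ⊢
  rw [Subfield.relfinrank_eq_finrank_of_le (le_sup_left : N ≤ N ⊔ Q)]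
  haveI : FiniteDimensional P (Subfield.extendScalars hPQ) :=
    FiniteDimensional.of_finrank_pos (Nat.pos_of_ne_zero hfin)
  have h1 := adjoin_rank_le_of_isAlgebraic_right N (Subfield.extendScalars hPQ)
  have h2 : adjoin N ((Subfield.extendScalars hPQ : IntermediateField P K) : Set K)
      = Subfield.extendScalars (le_sup_left : N ≤ N ⊔ Q) := by
    apply le_antisymm
    · rw [adjoin_le_iff]
      exact fun x hx => (le_sup_right : Q ≤ N ⊔ Q) hx
    · have : N ⊔ Q ≤ (adjoin N ((Subfield.extendScalars hPQ : IntermediateField P K) : Set K)).toSubfield :=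
        sup_le (fun x hx => IntermediateField.algebraMap_mem (adjoin N ((Subfield.extendScalars hPQ : IntermediateField P K) : Set K)) ⟨x, hx⟩)
          (fun x hx => subset_adjoin N _ hx)
      exact this
  rw [h2] at h1
  exact Cardinal.toNat_le_toNat h1 (rank_lt_aleph0 _ _)
end aux

section aux2
open Module

theorem aux_mono {p : ℕ} (hp : p.Prime) {k L K : Type*} [Field k] [Field K] [Algebra k K] [Field L]
    [Algebra k L] [CharP k p] [FiniteDimensional k K] (f : L →ₐ[k] K) :
    finrank (pClosure k L p) L ≤ finrank (pClosure k K p) K := by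
  haveI : Fact p.Prime := ⟨hp⟩
  haveI : CharP K p := charP_of_injective_algebraMap (algebraMap k K).injective p
  let A : IntermediateField k K := IntermediateField.map f ⊤
  let N : IntermediateField k K := IntermediateField.map f (pClosure k L p)
  let P : Subfield K := A.toSubfield.map (frobenius K p)
  let Q : Subfield K := (⊤ : Subfield K).map (frobenius K p)
  let M : IntermediateField k K := pClosure k K p
  have hNA : N ≤ A := IntermediateField.map_mono f le_top
  have hPN : P ≤ N.toSubfield := by
    rintro _ ⟨_, ⟨l, -, rfl⟩, rfl⟩
    exact ⟨l ^ p, subset_adjoin k _ ⟨l, rfl⟩, by simp [frobenius_def]⟩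
  have hPQ : P ≤ Q := by
    rintro _ ⟨x, -, rfl⟩
    exact ⟨x, trivial, rfl⟩
  have hNM : N ≤ M := by
    rw [show N = _ from adjoin_map k _ f]
    rw [adjoin_le_iff]
    rintro _ ⟨_, ⟨y, rfl⟩, rfl⟩
    exact subset_adjoin k _ ⟨f y, by simp⟩
  have hM : N.toSubfield ⊔ Q = M.toSubfield := by
    apply le_antisymm
    · refine sup_le hNM ?_
      rintro _ ⟨y, -, rfl⟩
      exact subset_adjoin k _ ⟨y, rfl⟩
    · change Subfield.closure _ ≤ _
      rw [Subfield.closure_le]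
      rintro x (⟨a, rfl⟩ | ⟨y, rfl⟩)
      · exact (le_sup_left : N.toSubfield ≤ _) (IntermediateField.algebraMap_mem N a)
      · exact (le_sup_right : Q ≤ N.toSubfield ⊔ Q) ⟨y, trivial, rfl⟩
  have e1 : P.relfinrank Q = finrank A K := by
    rw [Subfield.relfinrank_map_map, Subfield.relfinrank_top_right]
    rfl
  have hpos : 0 < finrank A K := finrank_pos
  have e2 := aux_sub N.toSubfield P Q M.toSubfield hPN hPQ hM (by rw [e1]; exact hpos.ne')
  rw [e1] at e2
  have e3 : N.relfinrank A = finrank (pClosure k L p) L := by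
    rw [IntermediateField.relfinrank_map_map, IntermediateField.relfinrank_top_right]
  have e4 := IntermediateField.relfinrank_mul_finrank_top hNA
  have e5 := IntermediateField.relfinrank_mul_finrank_top hNM
  have e6 : N.relfinrank M ≤ finrank A K := e2
  rw [← e3]
  refine Nat.le_of_mul_le_mul_right ?_ hpos
  rw [e4, ← e5, mul_comm]
  exact Nat.mul_le_mul_left _ e6

theorem aux_pow_mem {p : ℕ} {k K : Type*} [Field k] [Field K] [Algebra k K] (x : K) :
    x ^ p ∈ (algebraMap (pClosure k K p) K).range :=
  ⟨⟨x ^ p, subset_adjoin k _ ⟨x, rfl⟩⟩, rfl⟩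

theorem aux_charP {p : ℕ} {k K : Type*} [Field k] [Field K] [Algebra k K] [CharP k p] :
    CharP (pClosure k K p) p := charP_of_injective_algebraMap (algebraMap k _).injective p

theorem aux_exists_rbasis {p : ℕ} (hp : p.Prime) (k K : Type*) [Field k] [Field K] [Algebra k K]
    [CharP k p] : ∃ B : Set K, RBasis k K p B ∧ Cardinal.mk B = diCard k K p := by
  haveI : CharP (pClosure k K p) p := aux_charP
  have hne : {c : Cardinal | ∃ B : Set K, RBasis k K p B ∧ Cardinal.mk B = c}.Nonempty := by
    obtain ⟨B, hB⟩ := aux_exists (F := pClosure k K p) hp aux_pow_mem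
    exact ⟨_, B, hB, rfl⟩
  exact csInf_mem hne

theorem aux_fin {p : ℕ} (hp : p.Prime) (k K : Type*) [Field k] [Field K] [Algebra k K]
    [CharP k p] (h : diCard k K p < Cardinal.aleph0) :
    ∃ s : Finset K, RBasis k K p (s : Set K) ∧ diCard k K p = s.card ∧
      finrank (pClosure k K p) K = p ^ s.card := by
  haveI : CharP (pClosure k K p) p := aux_charP
  obtain ⟨B, hB, hc⟩ := aux_exists_rbasis hp k K
  rw [← hc] at h ⊢
  obtain ⟨s, rfl⟩ := (Cardinal.lt_aleph0_iff_set_finite.1 h).exists_finset_coe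
  refine ⟨s, hB, by simp, ?_⟩
  rw [← aux_finrank (F := pClosure k K p) hp aux_pow_mem s hB.2, hB.1]
  exact finrank_top'.symm

theorem aux_lt {p : ℕ} (hp : p.Prime) (k K : Type*) [Field k] [Field K] [Algebra k K]
    [CharP k p] [FiniteDimensional k K] : diCard k K p < Cardinal.aleph0 := by
  haveI : CharP (pClosure k K p) p := aux_charP
  obtain ⟨B, hB, hc⟩ := aux_exists_rbasis hp k K
  rw [← hc, Cardinal.lt_aleph0_iff_set_finite]
  by_contra hinf
  obtain ⟨s, hs, hcard⟩ := Set.Infinite.exists_subset_card_eq hinf (finrank (pClosure k K p) K)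
  have h1 := aux_finrank (F := pClosure k K p) hp aux_pow_mem s (RFr.mono hB.2 hs)
  rw [hcard] at h1
  have h2 : finrank (pClosure k K p) (adjoin (pClosure k K p) (s : Set K)) ≤
      finrank (pClosure k K p) K := Submodule.finrank_le (Subalgebra.toSubmodule
        (adjoin (pClosure k K p) (s : Set K)).toSubalgebra)
  rw [h1] at h2
  exact absurd (Nat.lt_pow_self hp.one_lt (n := finrank (pClosure k K p) K)) (not_lt.2 h2)

/-- bounded exponent: generation -/
theorem aux_gen {p : ℕ} (hp : p.Prime) {k K : Type*} [Field k] [Field K] [Algebra k K]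
    [CharP k p] (e : ℕ) (he : ∀ x : K, x ^ p ^ e ∈ (algebraMap k K).range) (B : Set K)
    (hB : adjoin (pClosure k K p) B = ⊤) : adjoin k B = ⊤ := by
  haveI : Fact p.Prime := ⟨hp⟩
  haveI : CharP K p := charP_of_injective_algebraMap (algebraMap k K).injective p
  have htop : adjoin k ({x : K | ∃ y : K, y ^ p = x} ∪ B) = ⊤ := by
    rw [← adjoin_adjoin_left]
    change (adjoin (pClosure k K p) B).restrictScalars k = ⊤
    rw [hB, restrictScalars_top]
  have key : ∀ i : ℕ, adjoin k (B ∪ {x : K | ∃ y : K, y ^ p ^ i = x}) = ⊤ := by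
    intro i
    induction i with
    | zero => exact eq_top_iff.2 fun y _ => subset_adjoin k _ (Or.inr ⟨y, by simp⟩)
    | succ i ih =>
      rw [eq_top_iff, ← ih, adjoin_le_iff]
      rintro x (hx | ⟨y, rfl⟩)
      · exact subset_adjoin k _ (Or.inl hx)
      have hy : y ∈ adjoin k ({x : K | ∃ y : K, y ^ p = x} ∪ B) := by rw [htop]; trivial
      change y ^ p ^ i ∈ adjoin k (B ∪ {x : K | ∃ y : K, y ^ p ^ (i+1) = x})
      induction hy using adjoin_induction with
      | mem x hx =>
        rcases hx with ⟨z, rfl⟩ | hx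
        · exact subset_adjoin k _ (Or.inr ⟨z, by rw [← pow_mul, pow_succ']⟩)
        · have hx2 : x ∈ adjoin k (B ∪ {x : K | ∃ y : K, y ^ p ^ (i+1) = x}) :=
            subset_adjoin k _ (Or.inl hx)
          exact _root_.pow_mem hx2 _
      | algebraMap a => rw [← map_pow]; exact IntermediateField.algebraMap_mem _ _
      | add x y _ _ h1 h2 => rw [add_pow_char_pow]; exact add_mem h1 h2
      | inv x _ h1 => rw [inv_pow]; exact inv_mem h1
      | mul x y _ _ h1 h2 => rw [mul_pow]; exact mul_mem h1 h2
  rw [eq_top_iff, ← key e, adjoin_le_iff]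
  rintro x (hx | ⟨y, rfl⟩)
  · exact subset_adjoin k _ hx
  · obtain ⟨a, ha⟩ := he y
    rw [← ha]
    exact IntermediateField.algebraMap_mem _ a

theorem aux_expleq {p : ℕ} (hp : p.Prime) {k K : Type*} [Field k] [Field K] [Algebra k K]
    [CharP k p] (n : ℕ) (x : K) : x ∈ expleq k K p n ↔ x ^ p ^ n ∈ (algebraMap k K).range := by
  haveI : Fact p.Prime := ⟨hp⟩
  haveI : CharP K p := charP_of_injective_algebraMap (algebraMap k K).injective p
  refine ⟨fun hx => ?_, fun hx => subset_adjoin k _ hx⟩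
  change x ^ p ^ n ∈ (algebraMap k K).fieldRange
  induction hx using adjoin_induction with
  | mem x hx => exact hx
  | algebraMap a => exact ⟨a ^ p ^ n, map_pow _ _ _⟩
  | add x y _ _ h1 h2 => rw [add_pow_char_pow]; exact add_mem h1 h2
  | inv x _ h1 => rw [inv_pow]; exact inv_mem h1
  | mul x y _ _ h1 h2 => rw [mul_pow]; exact mul_mem h1 h2

theorem aux_expleq' {p : ℕ} (hp : p.Prime) {k K : Type*} [Field k] [Field K] [Algebra k K]
    [CharP k p] (n : ℕ) (x : expleq k K p n) :
    x ^ p ^ n ∈ (algebraMap k (expleq k K p n)).range := by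
  obtain ⟨a, ha⟩ := (aux_expleq hp n (x : K)).1 x.2
  exact ⟨a, Subtype.ext ha⟩

theorem aux_expleq_mono {p : ℕ} (hp : p.Prime) {k K : Type*} [Field k] [Field K] [Algebra k K]
    [CharP k p] {m n : ℕ} (h : m ≤ n) : expleq k K p m ≤ expleq k K p n := by
  intro x hx
  rw [aux_expleq hp] at hx ⊢
  obtain ⟨c, rfl⟩ := Nat.exists_eq_add_of_le h
  rw [pow_add, pow_mul]
  exact pow_mem hx _

theorem aux_finset {p : ℕ} (hp : p.Prime) {k K : Type*} [Field k] [Field K] [Algebra k K]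
    [CharP k p] [IsPurelyInseparable k K] (s : Finset K) :
    ∃ n, ∀ x ∈ s, x ∈ expleq k K p n := by
  classical
  haveI : Fact p.Prime := ⟨hp⟩
  induction s using Finset.induction_on with
  | empty => exact ⟨0, by simp⟩
  | insert x s _ ih =>
    obtain ⟨n, hn⟩ := ih
    obtain ⟨m, hm⟩ := IsPurelyInseparable.pow_mem k p x
    refine ⟨max m n, fun y hy => ?_⟩
    rcases Finset.mem_insert.1 hy with rfl | hy
    · exact aux_expleq_mono hp (le_max_left _ _) ((aux_expleq hp m y).2 hm)
    · exact aux_expleq_mono hp (le_max_right _ _) (hn y hy)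

theorem aux_le_di {p : ℕ} (k K : Type*) [Field k] [Field K] [Algebra k K] (n : ℕ) :
    diCard k (expleq k K p n) p ≤ di k K p :=
  le_ciSup (f := fun n : ℕ => diCard k (expleq k K p n) p) (Cardinal.bddAbove_of_small) n

theorem aux_le {p : ℕ} (hp : p.Prime) {k : Type*} {L K : Type*} [Field k] [Field K] [Algebra k K]
    [Field L] [Algebra k L] [CharP k p] [FiniteDimensional k K] (f : L →ₐ[k] K)
    {a b : ℕ} (ha : finrank (pClosure k L p) L = p ^ a) (hb : finrank (pClosure k K p) K = p ^ b) :
    a ≤ b := by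
  have := aux_mono hp f
  rw [ha, hb] at this
  exact (Nat.pow_le_pow_iff_right hp.one_lt).1 this

theorem aux_forward (p : ℕ) (hp : p.Prime) (k K : Type*) [Field k] [Field K] [Algebra k K]
    [CharP k p] [IsPurelyInseparable k K] [FiniteDimensional k K] :
    di k K p = diCard k K p := by
  obtain ⟨s, -, hs, hs'⟩ := aux_fin hp k K (aux_lt hp k K)
  apply le_antisymm
  · refine ciSup_le' fun n => ?_
    obtain ⟨t, -, ht, ht'⟩ := aux_fin hp k (expleq k K p n) (aux_lt hp k _)
    rw [hs, ht]
    exact_mod_cast aux_le hp (expleq k K p n).val ht' hs'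
  · obtain ⟨s0, hs0⟩ := IntermediateField.fg_of_noetherian (⊤ : IntermediateField k K)
    obtain ⟨n, hn⟩ := aux_finset hp (k := k) s0
    have htop : expleq k K p n = ⊤ := by
      rw [eq_top_iff, ← hs0, adjoin_le_iff]
      exact hn
    refine le_trans ?_ (aux_le_di k K n)
    obtain ⟨t, -, ht, ht'⟩ := aux_fin hp k (expleq k K p n) (aux_lt hp k _)
    rw [hs, ht]
    let f : K →ₐ[k] expleq k K p n :=
      (IntermediateField.inclusion htop.ge).comp IntermediateField.topEquiv.symm.toAlgHom
    exact_mod_cast aux_le hp f hs' ht'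

theorem aux_backward (p : ℕ) (hp : p.Prime) (k K : Type*) [Field k] [Field K] [Algebra k K]
    [CharP k p] [IsPurelyInseparable k K] (hq : di k K p < Cardinal.aleph0)
    (h : di k K p = diCard k K p) : FiniteDimensional k K := by
  classical
  obtain ⟨s, hsB, hs, -⟩ := aux_fin hp k K (h ▸ hq)
  suffices hmain : adjoin k (s : Set K) = ⊤ by
    haveI : FiniteDimensional k (adjoin k (s : Set K)) :=
      IntermediateField.finiteDimensional_adjoin
        (fun x _ => IsPurelyInseparable.isIntegral' k x)
    rw [hmain] at this
    exact IntermediateField.topEquiv.toLinearEquiv.finiteDimensional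
  rw [eq_top_iff]
  intro y _
  obtain ⟨n, hn⟩ := aux_finset hp (k := k) (insert y s)
  obtain ⟨t, -, ht, ht'⟩ := aux_fin hp k (expleq k K p n) ((aux_le_di k K n).trans_lt hq)
  have hle : t.card ≤ s.card := by
    have := aux_le_di (p := p) k K n
    rw [h, hs, ht] at this
    exact_mod_cast this
  let E := expleq k K p n
  let s' : Finset E := s.attach.image
    (fun x => (⟨x.1, hn x.1 (Finset.mem_insert_of_mem x.2)⟩ : E))
  have himg : Subtype.val '' (s' : Set E) = (s : Set K) := by
    ext x
    constructor
    · rintro ⟨z, hz, rfl⟩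
      obtain ⟨w, -, rfl⟩ := Finset.mem_image.1 hz
      exact w.2
    · intro hx
      exact ⟨⟨x, hn x (Finset.mem_insert_of_mem hx)⟩,
        Finset.mem_image.2 ⟨⟨x, hx⟩, Finset.mem_attach _ _, rfl⟩, rfl⟩
  have hcard : s'.card = s.card := by
    rw [Finset.card_image_of_injective, Finset.card_attach]
    intro a b hab
    exact Subtype.ext (congrArg (fun z : E => (z : K)) hab)
  haveI : CharP (pClosure k E p) p := aux_charP
  have hfree : RFr (pClosure k E p) (s' : Set E) := by
    intro x hx hx'
    have hxs : (x : K) ∈ (s : Set K) := himg ▸ ⟨x, hx, rfl⟩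
    apply hsB.2 x hxs
    have h1 : x ∈ adjoin k ({x : E | ∃ y : E, y ^ p = x} ∪ ((s' : Set E) \ {x})) := by
      rw [← adjoin_adjoin_left]; exact hx'
    have h2 : E.val x ∈ IntermediateField.map E.val
        (adjoin k ({x : E | ∃ y : E, y ^ p = x} ∪ ((s' : Set E) \ {x}))) := ⟨x, h1, rfl⟩
    rw [adjoin_map] at h2
    have h3 : adjoin k (E.val '' ({x : E | ∃ y : E, y ^ p = x} ∪ ((s' : Set E) \ {x}))) ≤
        (adjoin (pClosure k K p) ((s : Set K) \ {(x : K)})).restrictScalars k := by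
      rw [adjoin_le_iff]
      rintro _ ⟨z, (⟨w, rfl⟩ | hz), rfl⟩
      · exact IntermediateField.algebraMap_mem (adjoin (pClosure k K p) ((s : Set K) \ {(x : K)}))
          ⟨(w : K) ^ p, subset_adjoin k _ ⟨w, rfl⟩⟩
      · refine subset_adjoin (pClosure k K p) _ ⟨himg ▸ ⟨z, hz.1, rfl⟩, ?_⟩
        intro hzx
        exact hz.2 (Subtype.ext hzx)
    exact h3 h2
  have hfr := aux_finrank (F := pClosure k E p) hp aux_pow_mem s' hfree
  haveI : FiniteDimensional (pClosure k E p) E :=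
    FiniteDimensional.of_finrank_pos (by rw [ht']; exact pow_pos hp.pos _)
  have htop : adjoin (pClosure k E p) (s' : Set E) = ⊤ := by
    apply IntermediateField.eq_of_le_of_finrank_le le_top
    rw [hfr, hcard, IntermediateField.finrank_top', ht']
    exact Nat.pow_le_pow_right hp.pos hle
  have hgen := aux_gen hp n (aux_expleq' hp n) (s' : Set E) htop
  have hy : (⟨y, hn y (Finset.mem_insert_self _ _)⟩ : E) ∈ adjoin k (s' : Set E) := by
    rw [hgen]; trivial
  have hy2 : y ∈ IntermediateField.map E.val (adjoin k (s' : Set E)) := ⟨_, hy, rfl⟩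
  rw [adjoin_map] at hy2
  change y ∈ adjoin k (Subtype.val '' (s' : Set E)) at hy2
  rwa [himg] at hy2

end aux2

/-- A `q`-finite purely inseparable extension `K/k` is finite iff
`di(K/k) = di(K/k(K^p))` (the cardinality of an `r`-basis of `K/k`). -/
theorem finite_iff_di_eq_diCard
    (p : ℕ) [Fact p.Prime] (k K : Type*) [Field k] [Field K] [Algebra k K] [CharP k p]
    [IsPurelyInseparable k K]
    (hq : di k K p < Cardinal.aleph0) :
    FiniteDimensional k K ↔ di k K p = diCard k K p := by
  exact ⟨fun _ => aux_forward p Fact.out k K, fun h => aux_backward p Fact.out k K hq h⟩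
end

section
/- Let K/k be a relatively perfect and modular purely inseparable extension of characteristic p > 0. Then for every positive integer n, the extension (k^{p^{-n}} ∩ K)/k is equiexponential of exponent n; in particular k((k^{p^{-n}} ∩ K)^p) = k^{p^{-(n-1)}} ∩ K. -/
/-!
Common definitions: purely inseparable extension theory (r-bases, degree of
irrationality, relative perfect closure, modularity), following Fliouet,
"Extensions absolument lq-finies".
-/

open IntermediateField

section Aux

open Polynomial in
theorem aux_natDegree {E F : Type*} [Field E] [Field F] [Algebra E F] (p : ℕ) [Fact p.Prime]
    [CharP F p] {x : F} (h1 : x ^ p ∈ (algebraMap E F).range) (h2 : x ∉ (algebraMap E F).range) :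
    (minpoly E x).natDegree = p := by
  obtain ⟨a, ha⟩ := h1
  have hirr : Irreducible (X ^ p - C a : E[X]) := by
    apply X_pow_sub_C_irreducible_of_prime (Fact.out : p.Prime)
    intro b hb
    apply h2
    refine ⟨b, ?_⟩
    apply frobenius_inj F p
    simp only [frobenius_def]
    rw [← map_pow, hb, ha]
  have hp0 : p ≠ 0 := (Fact.out : p.Prime).ne_zero
  rw [← minpoly.eq_of_irreducible_of_monic hirr (by simp [ha]) (monic_X_pow_sub_C a hp0)]
  exact natDegree_X_pow_sub_C

theorem aux_mem_range {E F : Type*} [Field E] [Field F] [Algebra E F]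
    (L : IntermediateField E F) (x : F) : x ∈ (algebraMap L F).range ↔ x ∈ L := by
  constructor
  · rintro ⟨y, rfl⟩; exact y.2
  · intro h; exact ⟨⟨x, h⟩, rfl⟩

theorem aux_monomials {E F : Type*} [Field E] [Field F] [Algebra E F] (p : ℕ) [Fact p.Prime]
    [CharP F p] (m : ℕ) (s : Fin m → F) (h1 : ∀ i, s i ^ p ∈ (algebraMap E F).range)
    (h2 : ∀ i, s i ∉ adjoin E (s '' {j | j < i})) :
    LinearIndependent E (fun r : Fin m → Fin p => ∏ i, s i ^ (r i : ℕ)) := by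
  induction m with
  | zero =>
    simp only [Finset.univ_eq_empty, Finset.prod_empty]
    exact LinearIndependent.of_subsingleton (default) one_ne_zero
  | succ m ih =>
    have ih' := ih (fun i => s i.castSucc) (fun i => h1 _) (by
      intro i hi
      apply h2 i.castSucc
      refine adjoin.mono E _ _ ?_ hi
      rintro _ ⟨j, hj, rfl⟩
      exact ⟨j.castSucc, by simpa using hj, rfl⟩)
    set E' := adjoin E (s '' {j | j < Fin.last m}) with hE'
    have hmem : ∀ i : Fin m, s i.castSucc ∈ E' := fun i =>
      subset_adjoin _ _ ⟨i.castSucc, by simp [Fin.castSucc_lt_last], rfl⟩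
    have hd : (minpoly E' (s (Fin.last m))).natDegree = p := by
      apply aux_natDegree p
      · rw [aux_mem_range]
        obtain ⟨a, ha⟩ := h1 (Fin.last m)
        rw [← ha]; exact E'.algebraMap_mem a
      · rw [aux_mem_range]
        exact h2 _
    have hc : LinearIndependent E' (fun i : Fin p => s (Fin.last m) ^ (i : ℕ)) := by
      have := linearIndependent_pow (K := E') (s (Fin.last m))
      rwa [hd] at this
    have hb : LinearIndependent E (fun r : Fin m → Fin p =>
        (∏ i, (⟨s i.castSucc, hmem i⟩ : E') ^ (r i : ℕ))) := by
      apply LinearIndependent.of_comp E'.val.toLinearMap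
      have heq : (E'.val.toLinearMap ∘ fun r : Fin m → Fin p =>
          (∏ i, (⟨s i.castSucc, hmem i⟩ : E') ^ (r i : ℕ))) =
          fun r : Fin m → Fin p => ∏ i, s i.castSucc ^ (r i : ℕ) := by
        ext r
        simp
      rw [heq]
      exact ih'
    have := linearIndependent_smul hb hc
    rw [← linearIndependent_equiv ((Equiv.prodComm _ _).trans (Fin.snocEquiv (fun _ => Fin p)))]
    convert this using 1
    ext ⟨r, t⟩
    simp [Fin.prod_univ_castSucc, IntermediateField.smul_def]

theorem aux_exchange_s19 {E F : Type*} [Field E] [Field F] [Algebra E F] (p : ℕ) [Fact p.Prime]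
    [CharP F p] {x y : F} (hx : x ^ p ∈ (algebraMap E F).range) (hx' : x ∉ (algebraMap E F).range)
    (hy : y ^ p ∈ (algebraMap E F).range) (hxy : x ∈ adjoin E {y}) : y ∈ adjoin E {x} := by
  by_cases hy' : y ∈ (algebraMap E F).range
  · obtain ⟨a, rfl⟩ := hy'; exact IntermediateField.algebraMap_mem _ a
  have hp := (Fact.out : p.Prime)
  have hdx := aux_natDegree p hx hx'
  have hdy := aux_natDegree p hy hy'
  have hix : IsIntegral E x := by
    by_contra h; rw [minpoly.eq_zero h] at hdx; simp at hdx; exact hp.ne_zero hdx.symm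
  have hiy : IsIntegral E y := by
    by_contra h; rw [minpoly.eq_zero h] at hdy; simp at hdy; exact hp.ne_zero hdy.symm
  have := adjoin.finiteDimensional hiy
  have h := IntermediateField.eq_of_le_of_finrank_eq (F := E⟮x⟯) (E := E⟮y⟯)
    (adjoin_simple_le_iff.2 hxy) (by rw [adjoin.finrank hix, adjoin.finrank hiy, hdx, hdy])
  rw [h]; exact mem_adjoin_simple_self E y

/-- existence of a maximal r-free set -/
theorem aux_rbasis {E F : Type*} [Field E] [Field F] [Algebra E F] (p : ℕ) [Fact p.Prime]
    [CharP F p] (L : Set F) (hL : ∀ x ∈ L, x ^ p ∈ (algebraMap E F).range) :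
    ∃ B ⊆ L, L ⊆ adjoin E B ∧ ∀ x ∈ B, x ∉ adjoin E (B \ {x}) := by
  obtain ⟨B, hB⟩ := zorn_subset {B : Set F | B ⊆ L ∧ ∀ x ∈ B, x ∉ adjoin E (B \ {x})} (by
    intro c hc hch
    refine ⟨⋃₀ c, ⟨Set.sUnion_subset fun t ht => (hc ht).1, ?_⟩, fun t ht =>
      Set.subset_sUnion_of_mem ht⟩
    rintro x ⟨t, ht, hxt⟩ hx
    obtain ⟨T, hT, hxT⟩ := exists_finset_of_mem_adjoin hx
    have : ∃ u ∈ c, x ∈ u ∧ (T : Set F) ⊆ u := by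
      have h2 : (T : Set F) ⊆ ⋃₀ c := fun z hz => (hT hz).1
      obtain ⟨v, hv, hTv⟩ := hch.directedOn.exists_mem_subset_of_finite_of_subset_sUnion
        ⟨t, ht⟩ T.finite_toSet h2
      rcases hch.total ht hv with h | h
      · exact ⟨v, hv, h hxt, hTv⟩
      · exact ⟨t, ht, hxt, hTv.trans h⟩
    obtain ⟨u, hu, hxu, hTu⟩ := this
    exact (hc hu).2 x hxu (adjoin.mono E (T : Set F) (u \ {x})
      (fun z hz => ⟨hTu hz, (hT hz).2⟩) hxT))
  refine ⟨B, hB.prop.1, ?_, hB.prop.2⟩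
  intro y hy
  by_contra hyB
  have hyB' : y ∉ B := fun h => hyB (subset_adjoin _ _ h)
  have hins : insert y B ∈ {B : Set F | B ⊆ L ∧ ∀ x ∈ B, x ∉ adjoin E (B \ {x})} := by
    refine ⟨Set.insert_subset hy hB.prop.1, ?_⟩
    rintro x (rfl | hx) hxm
    · rw [Set.insert_sdiff_self_of_notMem hyB'] at hxm
      exact hyB hxm
    · have hne : y ≠ x := fun h => hyB' (h ▸ hx)
      set E' := adjoin E (B \ {x}) with hE'
      have key : x ∈ adjoin E' {y} := by
        have : x ∈ (adjoin E' {y}).restrictScalars E := by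
          rw [hE', adjoin_adjoin_left]
          refine adjoin.mono E _ _ ?_ hxm
          rintro z ⟨rfl | hz, hzx⟩
          · right; rfl
          · left; exact ⟨hz, hzx⟩
        exact this
      have hr : ∀ z ∈ L, z ^ p ∈ (algebraMap E' F).range := by
        intro z hz
        obtain ⟨a, ha⟩ := hL z hz
        rw [aux_mem_range, ← ha]; exact E'.algebraMap_mem a
      have := aux_exchange_s19 p (hr x (hB.prop.1 hx)) (by rw [aux_mem_range]; exact hB.prop.2 x hx)
        (hr y hy) key
      apply hyB
      have h3 : y ∈ (adjoin E' {x}).restrictScalars E := this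
      rw [hE', adjoin_adjoin_left] at h3
      refine adjoin.mono E _ _ ?_ h3
      rintro z (hz | rfl)
      · exact hz.1
      · exact hx
  exact hyB' (hB.le_of_ge hins (Set.subset_insert _ _) (Set.mem_insert _ _))

theorem aux_mem_expleq {k K : Type*} [Field k] [Field K] [Algebra k K] (p : ℕ) [Fact p.Prime]
    [CharP K p] (n : ℕ) (x : K) :
    x ∈ expleq k K p n ↔ x ^ p ^ n ∈ (algebraMap k K).range := by
  constructor
  · intro hx
    let L : IntermediateField k K :=
      { ((algebraMap k K).fieldRange.comap (iterateFrobenius K p n)) with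
        algebraMap_mem' := fun r => by
          change iterateFrobenius K p n (algebraMap k K r) ∈ (algebraMap k K).fieldRange
          rw [iterateFrobenius_def, ← map_pow]
          exact ⟨_, rfl⟩ }
    have : expleq k K p n ≤ L := by
      unfold expleq
      rw [adjoin_le_iff]
      intro y hy
      exact hy
    exact this hx
  · intro h
    exact subset_adjoin _ _ h

theorem aux_mem_pnPowers {K : Type*} [Field K] (p : ℕ) [Fact p.Prime]
    [CharP K p] (n : ℕ) (x : K) : x ∈ pnPowers K p n ↔ ∃ y : K, y ^ p ^ n = x := by
  constructor
  · intro hx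
    have : pnPowers K p n ≤ (iterateFrobenius K p n).fieldRange := by
      unfold pnPowers
      rw [Subfield.closure_le]
      rintro _ ⟨y, rfl⟩
      exact ⟨y, iterateFrobenius_def p n y⟩
    obtain ⟨y, hy⟩ := this hx
    exact ⟨y, hy⟩
  · intro h; exact Subfield.subset_closure h

theorem aux_pow_inj {K : Type*} [Field K] (p : ℕ) [Fact p.Prime] [CharP K p] (n : ℕ) {x y : K}
    (h : x ^ p ^ n = y ^ p ^ n) : x = y := iterateFrobenius_inj K p n h

theorem aux_modular {k K : Type*} [Field k] [Field K] [Algebra k K] (p : ℕ) [Fact p.Prime]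
    [CharP K p] (hmod : Modular k K p) (n : ℕ) {ι : Type*} (v : ι → K)
    (hv : LinearIndependent (expleq k K p n) v) :
    LinearIndependent k (fun i => v i ^ p ^ n) := by
  have hinj : Function.Injective (fun i => v i ^ p ^ n) := fun i j h =>
    hv.injective (aux_pow_inj p n h)
  have h0 : LinearIndependent ↥(pnPowers K p n ⊓ (algebraMap k K).fieldRange)
      (fun i => v i ^ p ^ n) := by
    rw [linearIndependent_iff']
    intro s g hg i hi
    have hd : ∀ i, ∃ d : expleq k K p n, (d : K) ^ p ^ n = g i := by
      intro i
      obtain ⟨y, hy⟩ := (aux_mem_pnPowers p n _).1 (g i).2.1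
      exact ⟨⟨y, (aux_mem_expleq p n y).2 (by rw [hy]; exact (g i).2.2)⟩, hy⟩
    choose d hd using hd
    have : ∑ i ∈ s, d i • v i = 0 := by
      apply aux_pow_inj p n
      rw [sum_pow_char_pow, zero_pow (pow_ne_zero _ (Fact.out : p.Prime).ne_zero)]
      rw [← hg]
      apply Finset.sum_congr rfl
      intro i _
      rw [IntermediateField.smul_def, smul_eq_mul, mul_pow, hd, Subfield.smul_def, smul_eq_mul]
    have := linearIndependent_iff'.1 hv s d this i hi
    apply Subtype.ext
    rw [← hd, this]
    simp [zero_pow (pow_ne_zero n (Fact.out : p.Prime).ne_zero)]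
  have h1 : LinearIndependent ↥((algebraMap k K).fieldRange) (fun i => v i ^ p ^ n) := by
    rw [← linearIndepOn_id_range_iff hinj]
    apply linearIndepOn_of_finite (v := id)
    intro t ht htf
    have := hmod n htf.toFinset (by
      intro x hx
      obtain ⟨i, rfl⟩ := ht (by simpa using hx)
      exact (aux_mem_pnPowers p n _).2 ⟨_, rfl⟩) (by
      have h2 := (linearIndepOn_id_range_iff hinj).2 h0
      have h4 : LinearIndepOn ↥(pnPowers K p n ⊓ (algebraMap k K).fieldRange) id
          (htf.toFinset : Set K) := LinearIndepOn.mono h2 (by simpa using ht)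
      exact h4)
    have h3 : LinearIndepOn (algebraMap k K).fieldRange id (htf.toFinset : Set K) := this
    rwa [Set.Finite.coe_toFinset] at h3
  rw [linearIndependent_iff'] at h1 ⊢
  intro s g hg i hi
  have := h1 s (fun i => ⟨algebraMap k K (g i), ⟨_, rfl⟩⟩) (by
    rw [← hg]
    apply Finset.sum_congr rfl
    intro i _
    rw [Subfield.smul_def, smul_eq_mul, Algebra.smul_def]) i hi
  have := congrArg Subtype.val this
  simpa using this

/-- coefficient extraction -/
theorem aux_coeff {k K : Type*} [Field k] [Field K] [Algebra k K] (p : ℕ) [Fact p.Prime]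
    [CharP K p] (j : ℕ) {ι : Type*} (s : Finset ι) (d w : ι → K) (i₀ : ι) (x : K)
    (hx : x ^ p ^ j ∈ (algebraMap k K).range) (hxs : x = ∑ i ∈ s, d i * w i)
    (hd : ∀ i, d i ^ p ^ j ∈ (algebraMap k K).range)
    (hw : LinearIndependent k (fun i => w i ^ p ^ j)) (h1 : w i₀ = 1) (hi₀ : i₀ ∈ s) :
    x = d i₀ := by
  classical
  obtain ⟨c, hc⟩ := hx
  choose e he using hd
  apply aux_pow_inj p j
  have hsum : ∑ i ∈ s, (e i - if i = i₀ then c else 0) • w i ^ p ^ j = 0 := by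
    simp only [sub_smul, Finset.sum_sub_distrib, ite_smul, zero_smul, Finset.sum_ite_eq', hi₀,
      if_true, h1, one_pow]
    rw [Algebra.smul_def, hc, mul_one, hxs, sum_pow_char_pow, sub_eq_zero]
    apply Finset.sum_congr rfl
    intro i _
    rw [Algebra.smul_def, he, mul_pow]
  have := linearIndependent_iff'.1 hw s _ hsum i₀ hi₀
  simp only [if_true, sub_eq_zero] at this
  rw [← hc, ← he, this]

theorem aux_pclosure {k K : Type*} [Field k] [Field K] [Algebra k K] (p : ℕ) [Fact p.Prime]
    [CharP K p] [Algebra.IsAlgebraic k K] (hrp : pClosure k K p = ⊤) (hmod : Modular k K p)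
    (N : ℕ) : pClosureOf p (expleq k K p (N + 1)) = expleq k K p N := by
  have hle : pClosureOf p (expleq k K p (N + 1)) ≤ expleq k K p N := by
    unfold pClosureOf
    rw [adjoin_le_iff]
    rintro _ ⟨y, hy, rfl⟩
    rw [SetLike.mem_coe, aux_mem_expleq, ← pow_mul, ← pow_succ']
    exact (aux_mem_expleq p _ y).1 hy
  refine le_antisymm hle ?_
  intro x hx
  have hli : LinearIndepOn (expleq k K p (N + 1)) id ({1} : Set K) :=
    (linearIndepOn_singleton_iff _).2 one_ne_zero
  let b := Module.Basis.extend hli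
  let i₀ : hli.extend (Set.subset_univ _) :=
    ⟨1, Module.Basis.subset_extend hli (Set.mem_singleton 1)⟩
  have hi₀ : b i₀ = 1 := Module.Basis.extend_apply_self hli i₀
  have hspan : ∀ z : K, z ∈ Submodule.span (pClosureOf p (expleq k K p (N + 1)))
      (Set.range fun i => b i ^ p) := by
    intro z
    have hz : z ∈ pClosure k K p := by rw [hrp]; trivial
    unfold pClosure at hz
    rw [← mem_toSubalgebra, adjoin_toSubalgebra, ← Subalgebra.mem_toSubmodule,
      Algebra.adjoin_eq_span] at hz
    induction hz using Submodule.span_induction with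
    | zero => exact Submodule.zero_mem _
    | add _ _ _ _ h1 h2 => exact Submodule.add_mem _ h1 h2
    | smul r y _ h =>
      have := Submodule.smul_mem _ (algebraMap k (pClosureOf p (expleq k K p (N + 1))) r) h
      rwa [algebraMap_smul] at this
    | mem y hy =>
      have hle2 : Submonoid.closure {x : K | ∃ y : K, y ^ p = x} ≤
          Submonoid.map (powMonoidHom p) (⊤ : Submonoid K) := by
        rw [Submonoid.closure_le]
        rintro _ ⟨y, rfl⟩
        exact ⟨y, trivial, rfl⟩
      obtain ⟨u, -, rfl⟩ := hle2 hy
      change u ^ p ∈ _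
      rw [← b.linearCombination_repr u, Finsupp.linearCombination_apply, Finsupp.sum,
        sum_pow_char]
      refine Submodule.sum_mem _ fun i _ => ?_
      have hm : ((b.repr u i : expleq k K p (N + 1)) : K) ^ p ∈
          pClosureOf p (expleq k K p (N + 1)) := subset_adjoin _ _ ⟨_, (b.repr u i).2, rfl⟩
      have := Submodule.smul_mem (Submodule.span (pClosureOf p (expleq k K p (N + 1)))
        (Set.range fun i => b i ^ p)) ⟨_, hm⟩ (Submodule.subset_span ⟨i, rfl⟩)
      rwa [IntermediateField.smul_def, smul_eq_mul, ← mul_pow] at this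
  obtain ⟨c, hc⟩ := Finsupp.mem_span_range_iff_exists_finsupp.1 (hspan x)
  classical
  have hmod' := aux_modular p hmod (N + 1) b b.linearIndependent
  have := aux_coeff (k := k) p N (insert i₀ c.support) (fun i => (c i : K)) (fun i => b i ^ p) i₀ x
    ((aux_mem_expleq p N x).1 hx)
    (by
      rw [← hc, Finsupp.sum_of_support_subset c (Finset.subset_insert i₀ _) _ (by simp)]
      rfl)
    (fun i => (aux_mem_expleq p N _).1 (hle (c i).2))
    (by simpa only [← pow_mul, ← pow_succ'] using hmod')
    (by simp [hi₀]) (Finset.mem_insert_self _ _)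
  rw [this]
  exact (c i₀).2

theorem aux_reduce {k K : Type*} [Field k] [Field K] [Algebra k K] (p : ℕ) [Fact p.Prime]
    [Algebra.IsAlgebraic k K] {m : ℕ} (t : Fin m → K) (x : K)
    (hx : x ∈ adjoin k (Set.range t)) :
    ∃ d : (Fin m → Fin p) → K, (∀ r, d r ∈ adjoin k (Set.range fun l => t l ^ p)) ∧
      x = ∑ r, d r * ∏ l, t l ^ (r l : ℕ) := by
  have hp : 0 < p := (Fact.out : p.Prime).pos
  rw [← mem_toSubalgebra, adjoin_toSubalgebra, Algebra.adjoin_range_eq_range_aeval] at hx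
  obtain ⟨P, rfl⟩ := hx
  have : MvPolynomial.aeval t P ∈ Submodule.span (adjoin k (Set.range fun l => t l ^ p))
      (Set.range fun r : Fin m → Fin p => ∏ l, t l ^ (r l : ℕ)) := by
    rw [MvPolynomial.aeval_def, MvPolynomial.eval₂_eq']
    refine Submodule.sum_mem _ fun e _ => ?_
    have hm : algebraMap k K (P.coeff e) * ∏ l, (t l ^ p) ^ (e l / p) ∈
        adjoin k (Set.range fun l => t l ^ p) := by
      refine mul_mem (IntermediateField.algebraMap_mem _ _) (prod_mem fun l _ => pow_mem ?_ _)
      exact subset_adjoin _ _ ⟨l, rfl⟩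
    have := Submodule.smul_mem (Submodule.span (adjoin k (Set.range fun l => t l ^ p))
      (Set.range fun r : Fin m → Fin p => ∏ l, t l ^ (r l : ℕ))) ⟨_, hm⟩
      (Submodule.subset_span ⟨fun l => ⟨e l % p, Nat.mod_lt _ hp⟩, rfl⟩)
    rw [IntermediateField.smul_def, smul_eq_mul] at this
    convert this using 1
    rw [mul_assoc, ← Finset.prod_mul_distrib]
    congr 1
    apply Finset.prod_congr rfl
    intro l _
    rw [← pow_mul, ← pow_add, Nat.div_add_mod]
  obtain ⟨c, hc⟩ := (Submodule.mem_span_range_iff_exists_fun _).1 this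
  exact ⟨fun r => c r, fun r => (c r).2, hc.symm⟩

theorem aux_expOf {k K : Type*} [Field k] [Field K] [Algebra k K] (p N : ℕ)
    (F : IntermediateField k K) (a : K) (h1 : a ^ p ^ (N + 1) ∈ F) (h2 : a ^ p ^ N ∉ F) :
    expOf p F a = N + 1 := by
  unfold expOf
  apply le_antisymm
  · exact Nat.sInf_le h1
  · refine le_csInf ⟨_, h1⟩ ?_
    intro m hm
    by_contra hlt
    apply h2
    obtain ⟨c, rfl⟩ : ∃ c, N = m + c := ⟨N - m, by omega⟩
    rw [pow_add, pow_mul]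
    exact pow_mem hm _

theorem aux_main {k K : Type*} [Field k] [Field K] [Algebra k K] (p : ℕ) [Fact p.Prime]
    [CharP K p] [Algebra.IsAlgebraic k K] (hmod : Modular k K p)
    (N : ℕ) (G : Set K) (hG : G ⊆ expleq k K p (N + 1))
    (hfree : ∀ x ∈ G, x ∉ adjoin (expleq k K p N) (G \ {x})) (a : K) (ha : a ∈ G) :
    a ^ p ^ N ∉ adjoin k (G \ {a}) := by
  intro hmem
  obtain ⟨T, hT, haT⟩ := exists_finset_of_mem_adjoin hmem
  obtain ⟨m, s, hsinj, hsr⟩ : ∃ (m : ℕ) (s : Fin m → K), Function.Injective s ∧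
      Set.range s = (T : Set K) :=
    ⟨T.card, fun l => (T.equivFin.symm l : K),
      Subtype.val_injective.comp T.equivFin.symm.injective, by
        ext z
        constructor
        · rintro ⟨l, rfl⟩; exact (T.equivFin.symm l).2
        · intro hz; exact ⟨T.equivFin ⟨z, hz⟩, by simp⟩⟩
  have hsG : ∀ l, s l ∈ G \ {a} := fun l => hT (hsr ▸ Set.mem_range_self l)
  have hsk : ∀ l, s l ^ p ^ (N + 1) ∈ (algebraMap k K).range := fun l =>
    (aux_mem_expleq p _ _).1 (hG (hsG l).1)
  have hmon : LinearIndependent (expleq k K p N)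
      (fun r : Fin m → Fin p => ∏ l, s l ^ (r l : ℕ)) := by
    apply aux_monomials p
    · intro l
      rw [aux_mem_range, aux_mem_expleq, ← pow_mul, ← pow_succ']
      exact hsk l
    · intro l hl
      refine hfree (s l) (hsG l).1 (adjoin.mono _ _ _ ?_ hl)
      rintro _ ⟨j, hj, rfl⟩
      exact ⟨(hsG j).1, fun h => (ne_of_lt hj) (hsinj h)⟩
  have hopt := linearIndependent_option'.2 ⟨hmon, (show a ∉ _ by
    intro h
    apply hfree a ha
    have hle : Submodule.span (expleq k K p N)
        (Set.range fun r : Fin m → Fin p => ∏ l, s l ^ (r l : ℕ)) ≤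
        Subalgebra.toSubmodule (adjoin (expleq k K p N) (G \ {a})).toSubalgebra := by
      rw [Submodule.span_le]
      rintro _ ⟨r, rfl⟩
      have hpm : ∏ l, s l ^ (r l : ℕ) ∈ adjoin (expleq k K p N) (G \ {a}) :=
        prod_mem fun l _ => pow_mem (subset_adjoin _ _ (hsG l)) _
      exact hpm
    exact hle h)⟩
  have hk := linearIndependent_option.1 (aux_modular p hmod N _ hopt)
  obtain ⟨hk1, hk2⟩ := hk
  have hk1' : LinearIndependent k
      (fun r : Fin m → Fin p => (∏ l, s l ^ (r l : ℕ)) ^ p ^ N) := hk1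
  have hk2' : a ^ p ^ N ∉ Submodule.span k
      (Set.range fun r : Fin m → Fin p => (∏ l, s l ^ (r l : ℕ)) ^ p ^ N) := hk2
  have hlow : ∀ i j, i + j = N → ∀ d ∈ adjoin k (Set.range fun l => (s l ^ p ^ i) ^ p),
      d ^ p ^ j ∈ (algebraMap k K).range := by
    intro i j hij d hd
    rw [← aux_mem_expleq]
    refine (adjoin_le_iff.2 ?_ : adjoin k _ ≤ expleq k K p j) hd
    rintro _ ⟨l, rfl⟩
    rw [SetLike.mem_coe, aux_mem_expleq, ← pow_mul, ← pow_mul, ← mul_assoc, ← pow_succ, ← pow_add]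
    have := hsk l
    rwa [show i + 1 + j = N + 1 by omega]
  have hclaim : ∀ i j, i + j = N → ∀ x ∈ adjoin k (Set.range s),
      x ^ p ^ (j + 1) ∈ (algebraMap k K).range →
      x ∈ adjoin k (Set.range fun l => s l ^ p ^ i) := by
    intro i
    induction i with
    | zero => intro j _ x hx _; simpa using hx
    | succ i ih =>
      intro j hij x hx hxj
      have hx1 := ih (j + 1) (by omega) x hx (by
        rw [pow_succ, pow_mul]
        exact Subring.pow_mem _ hxj p)
      obtain ⟨d, hd, hxd⟩ := aux_reduce p _ x hx1
      have := aux_coeff (k := k) p (j + 1) Finset.univ d _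
        (fun _ => ⟨0, (Fact.out : p.Prime).pos⟩) x hxj hxd
        (fun r => hlow i (j + 1) (by omega) _ (hd r))
        (by
          convert hk1' using 2 with r
          rw [← Finset.prod_pow, ← Finset.prod_pow]
          apply Finset.prod_congr rfl
          intro l _
          rw [← pow_mul, ← pow_mul, ← pow_mul, show N = i + (j + 1) by omega, pow_add]
          ring)
        (by simp) (Finset.mem_univ _)
      rw [this]
      have := hd (fun _ => ⟨0, (Fact.out : p.Prime).pos⟩)
      simpa only [← pow_mul, ← pow_succ] using this
  have hfin := hclaim N 0 (by omega) (a ^ p ^ N) (by rw [hsr]; exact haT) (by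
    rw [← pow_mul, zero_add, ← pow_add]
    exact (aux_mem_expleq p _ _).1 (hG ha))
  obtain ⟨d, hd, hxd⟩ := aux_reduce p _ _ hfin
  apply hk2'
  rw [hxd]
  refine Submodule.sum_mem _ fun r _ => ?_
  obtain ⟨c, hc⟩ := hlow N 0 (by omega) _ (hd r)
  rw [pow_zero, pow_one] at hc
  rw [← hc, ← Algebra.smul_def]
  apply Submodule.smul_mem
  apply Submodule.subset_span
  refine ⟨r, ?_⟩
  simp only
  rw [← Finset.prod_pow]
  apply Finset.prod_congr rfl
  intro l _
  rw [← pow_mul, ← pow_mul, mul_comm]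

end Aux

/-- If `K/k` is purely inseparable, relatively perfect and modular,
then for every `n ≥ 1` the extension `(k^{p^{-n}} ∩ K)/k` is equiexponential of
exponent `n`; in particular `k((k^{p^{-n}} ∩ K)^p) = k^{p^{-(n-1)}} ∩ K`. -/
theorem expleq_equiexponential_of_relPerfect_modular
    (p : ℕ) [Fact p.Prime] (k K : Type*) [Field k] [Field K] [Algebra k K] [CharP k p]
    [IsPurelyInseparable k K]
    (hrp : pClosure k K p = ⊤)
    (hmod : Modular k K p)
    (n : ℕ) (hn : 1 ≤ n) :
    EquiExpOf p n (expleq k K p n) ∧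
      pClosureOf p (expleq k K p n) = expleq k K p (n - 1) := by
  obtain ⟨N, rfl⟩ : ∃ N, n = N + 1 := ⟨n - 1, by omega⟩
  have : CharP K p := charP_of_injective_algebraMap (algebraMap k K).injective p
  have hpc := aux_pclosure p hrp hmod N
  refine ⟨?_, by simpa using hpc⟩
  obtain ⟨B, hB1, hB2, hB3⟩ := aux_rbasis (E := expleq k K p N) p (expleq k K p (N + 1) : Set K) (by
    intro x hx
    rw [aux_mem_range, aux_mem_expleq, ← pow_mul, ← pow_succ']
    exact (aux_mem_expleq p _ x).1 hx)
  have hmono : expleq k K p N ≤ expleq k K p (N + 1) := by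
    intro x hx
    rw [aux_mem_expleq] at hx ⊢
    rw [pow_succ, pow_mul]
    exact Subring.pow_mem _ hx p
  refine ⟨B, ⟨hB1, ?_, ?_⟩, ?_⟩
  · rw [hpc, bot_sup_eq]
    apply le_antisymm
    · exact sup_le hmono (adjoin_le_iff.2 hB1)
    · rw [← restrictScalars_adjoin_eq_sup]
      exact hB2
  · intro x hx
    rw [hpc, bot_sup_eq, ← restrictScalars_adjoin_eq_sup]
    exact hB3 x hx
  · intro a ha
    have hmain := aux_main p hmod N B hB1 hB3 a ha
    have hak : a ^ p ^ (N + 1) ∈ (⊥ : IntermediateField k K) :=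
      IntermediateField.mem_bot.2 ((aux_mem_expleq p _ a).1 (hB1 ha))
    exact ⟨aux_expOf p N _ a (bot_le (a := adjoin k (B \ {a})) hak) hmain,
      aux_expOf p N _ a hak fun h => hmain (bot_le (a := adjoin k (B \ {a})) h)⟩
end
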